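/- Let n ≥ 1, let Φ : FreeGroup (Fin n) ≃* FreeGroup (Fin n) be an automorphism, and let x ∈ FreeGroup (Fin n) with x ≠ 1. Then there exists a real number λ ≥ 1 such that the sequence k ↦ (1/k)·log ‖Φ^k(x)‖_c converges to log λ as k → ∞, where ‖y‖_c denotes the cyclic (conjugacy) length of y. In other words, every conjugacy class has a well-defined asymptotic exponential growth rate λ_{Φ,x} under iteration of Φ. -/

import Mathlib

/-- The cyclic (conjugacy) length of an element of a free group: the minimum of the
word length `FreeGroup.norm` over the conjugacy class. -/
noncomputable def cyclicLength {n : ℕ} (y : FreeGroup (Fin n)) : ℕ :=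
  sInf {m : ℕ | ∃ g : FreeGroup (Fin n), FreeGroup.norm (g * y * g⁻¹) = m}

namespace GrowthRate

open FreeGroup

section TreeMetric

variable {α : Type*} [DecidableEq α]

/-- Length of the longest common prefix of two lists. -/
def commonPrefixLength {β : Type*} [DecidableEq β] : List β → List β → ℕ
  | a :: l, b :: m => if a = b then commonPrefixLength l m + 1 else 0
  | _, _ => 0

lemma commonPrefixLength_ultrametric {β : Type*} [DecidableEq β] (l m k : List β) :
    min (commonPrefixLength l m) (commonPrefixLength m k) ≤ commonPrefixLength l k := by
  induction l generalizing m k with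
  | nil => cases m <;> simp [commonPrefixLength]
  | cons a l ih =>
    cases m with
    | nil => simp [commonPrefixLength]
    | cons b m =>
      cases k with
      | nil => simp [commonPrefixLength]
      | cons c k =>
        have := ih m k
        simp only [commonPrefixLength]
        split_ifs <;> simp_all

lemma exists_commonPrefix {β : Type*} [DecidableEq β] (l m : List β) :
    ∃ p s t, l = p ++ s ∧ m = p ++ t ∧ p.length = commonPrefixLength l m ∧
      ∀ a ∈ s.head?, ∀ b ∈ t.head?, a ≠ b := by
  induction l generalizing m with
  | nil => exact ⟨[], [], m, by simp [commonPrefixLength]⟩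
  | cons a l ih =>
    cases m with
    | nil => exact ⟨[], a :: l, [], by simp [commonPrefixLength]⟩
    | cons b m =>
      by_cases hab : a = b
      · obtain ⟨p, s, t, rfl, rfl, hp, h⟩ := ih m
        exact ⟨a :: p, s, t, by simp, by simp [hab], by simp [commonPrefixLength, hab, hp], h⟩
      · exact ⟨[], a :: l, b :: m, by simp [commonPrefixLength, hab]⟩

lemma isReduced_append {β : Type*} {l m : List (β × Bool)} (hl : IsReduced l) (hm : IsReduced m)
    (h : ∀ a ∈ l.getLast?, ∀ b ∈ m.head?, a.1 = b.1 → a.2 = b.2) : IsReduced (l ++ m) :=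
  List.isChain_append.2 ⟨hl, hm, h⟩

lemma isReduced_invRev {l : List (α × Bool)} (hl : IsReduced l) : IsReduced (invRev l) := by
  rw [isReduced_iff_reduce_eq, reduce_invRev, hl.reduce_eq]

lemma norm_mk_of_isReduced {l : List (α × Bool)} (hl : IsReduced l) :
    (mk l).norm = l.length := by
  rw [FreeGroup.norm, toWord_mk, hl.reduce_eq]

lemma norm_inv_mul (a b : FreeGroup α) :
    (a⁻¹ * b).norm + 2 * commonPrefixLength a.toWord b.toWord = a.norm + b.norm := by
  obtain ⟨p, s, t, ha, hb, hp, h⟩ := exists_commonPrefix a.toWord b.toWord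
  have hra : IsReduced (p ++ s) := ha ▸ isReduced_toWord
  have hrb : IsReduced (p ++ t) := hb ▸ isReduced_toWord
  have hs : IsReduced s := (List.isChain_append.1 hra).2.1
  have ht : IsReduced t := (List.isChain_append.1 hrb).2.1
  have hab : a⁻¹ * b = mk (invRev s ++ t) := by
    rw [← mk_toWord (x := a), ← mk_toWord (x := b), ha, hb, ← mul_mk, ← mul_mk, ← mul_mk,
      ← inv_mk]
    group
  have hred : IsReduced (invRev s ++ t) := by
    refine isReduced_append (isReduced_invRev hs) ht fun x hx y hy hxy => ?_
    rcases s with _ | ⟨z, s⟩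
    · simp at hx
    · have hzy : z ≠ y := h z (by simp) y hy
      have hxz : x = (z.1, !z.2) := by
        simpa [invRev, eq_comm] using hx
      subst hxz
      by_contra hne
      apply hzy
      refine Prod.ext hxy ?_
      revert hne
      cases z.2 <;> cases y.2 <;> simp
  rw [hab, norm_mk_of_isReduced hred, FreeGroup.norm, FreeGroup.norm, ← hp, ha, hb]
  simp [invRev_length]
  omega

/-- The word metric of a free group, with integer values. -/
def wd (a b : FreeGroup α) : ℤ := ((a⁻¹ * b).norm : ℤ)

lemma wd_mul_left (g a b : FreeGroup α) : wd (g * a) (g * b) = wd a b := by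
  simp [wd, mul_assoc]

lemma wd_nonneg (a b : FreeGroup α) : 0 ≤ wd a b := by simp [wd]

lemma wd_comm (a b : FreeGroup α) : wd a b = wd b a := by
  rw [wd, wd, ← norm_inv_eq]; simp

lemma wd_self (a : FreeGroup α) : wd a a = 0 := by simp [wd]

lemma wd_eq_zero {a b : FreeGroup α} : wd a b = 0 ↔ a = b := by
  simp [wd, inv_mul_eq_one]

lemma wd_triangle (a b c : FreeGroup α) : wd a c ≤ wd a b + wd b c := by
  have := norm_mul_le (a⁻¹ * b) (b⁻¹ * c)
  simp only [wd]
  rw [show a⁻¹ * b * (b⁻¹ * c) = a⁻¹ * c by group] at this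
  exact_mod_cast this

lemma wd_one (a : FreeGroup α) : wd 1 a = a.norm := by simp [wd]

/-- The excess of the path from `a` to `b` through `x`: twice the distance from `x` to the
geodesic from `a` to `b`. -/
def ex (a x b : FreeGroup α) : ℤ := wd a x + wd x b - wd a b

lemma ex_mul_left (g a x b : FreeGroup α) : ex (g * a) (g * x) (g * b) = ex a x b := by
  simp [ex, wd_mul_left]

lemma ex_nonneg (a x b : FreeGroup α) : 0 ≤ ex a x b := by
  have := wd_triangle a x b
  unfold ex; omega

lemma ex_comm (a x b : FreeGroup α) : ex a x b = ex b x a := by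
  unfold ex; rw [wd_comm a x, wd_comm x b, wd_comm a b]; ring

lemma ex_left (a b : FreeGroup α) : ex a a b = 0 := by simp [ex, wd_self]

lemma ex_right (a b : FreeGroup α) : ex a b b = 0 := by simp [ex, wd_self]

lemma ex_one_eq (a b : FreeGroup α) :
    ex a 1 b = 2 * commonPrefixLength a.toWord b.toWord := by
  have := norm_inv_mul a b
  simp only [ex]
  rw [wd_comm a 1, wd_one, wd_one, wd]
  omega

lemma ex_min (a x b c : FreeGroup α) : min (ex a x c) (ex c x b) ≤ ex a x b := by
  rw [← ex_mul_left x⁻¹ a x c, ← ex_mul_left x⁻¹ c x b, ← ex_mul_left x⁻¹ a x b,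
    inv_mul_cancel, ex_one_eq, ex_one_eq, ex_one_eq]
  have := commonPrefixLength_ultrametric (x⁻¹ * a).toWord (x⁻¹ * c).toWord (x⁻¹ * b).toWord
  omega

lemma ex_eq_zero_split {a x b : FreeGroup α} (h : ex a x b = 0) (c : FreeGroup α) :
    ex a x c = 0 ∨ ex c x b = 0 := by
  have h₁ := ex_min a x b c
  have h₂ := ex_nonneg a x c
  have h₃ := ex_nonneg c x b
  omega

lemma exists_median (a b c : FreeGroup α) :
    ∃ m, ex a m b = 0 ∧ ex b m c = 0 ∧ ex a m c = 0 := by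
  obtain ⟨p, s, t, ha, hb, hp, -⟩ := exists_commonPrefix (c⁻¹ * a).toWord (c⁻¹ * b).toWord
  have key : ∀ (x : FreeGroup α) s, x.toWord = p ++ s → ((mk p)⁻¹ * x).norm = s.length := by
    intro x s hx
    have hr : IsReduced (p ++ s) := hx ▸ isReduced_toWord
    rw [← norm_mk_of_isReduced (List.isChain_append.1 hr).2.1, ← mk_toWord (x := x), hx,
      ← mul_mk, inv_mul_cancel_left]
  have hpn : (mk p).norm = p.length := by
    have hr : IsReduced (p ++ s) := ha ▸ isReduced_toWord
    exact norm_mk_of_isReduced (List.isChain_append.1 hr).1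
  have h₀ := ex_one_eq (c⁻¹ * a) (c⁻¹ * b)
  have h₁ : wd a (c * mk p) = s.length := by
    rw [wd_comm, wd, ← key _ _ ha]; simp [mul_assoc]
  have h₂ : wd b (c * mk p) = t.length := by
    rw [wd_comm, wd, ← key _ _ hb]; simp [mul_assoc]
  have h₃ : wd c (c * mk p) = p.length := by
    rw [wd, ← hpn]; simp
  have h₄ : wd c a = p.length + s.length := by
    rw [wd, FreeGroup.norm, ha]; simp
  have h₅ : wd c b = p.length + t.length := by
    rw [wd, FreeGroup.norm, hb]; simp
  have h₆ := ex_mul_left c⁻¹ a c b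
  rw [inv_mul_cancel, h₀, ← hp] at h₆
  have h₇ := wd_comm c a
  have h₈ := wd_comm (c * mk p) b
  have h₉ := wd_comm (c * mk p) c
  have h₁₀ := wd_comm c b
  refine ⟨c * mk p, ?_, ?_, ?_⟩ <;> simp only [ex] at h₆ ⊢ <;> omega

/-- Geodesics: a sequence of points at unit distance from `a` to `b`. -/
lemma exists_geodesic (a b : FreeGroup α) :
    ∃ (s : ℕ → FreeGroup α) (n : ℕ), s 0 = a ∧ s n = b ∧ (∀ i, wd (s i) (s (i + 1)) ≤ 1) ∧
      (∀ i ≤ n, ex a (s i) b = 0) ∧ wd a b = n := by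
  set w := (a⁻¹ * b).toWord with hw
  have hr : IsReduced w := isReduced_toWord
  have hb : b = a * mk w := by rw [hw, mk_toWord]; group
  refine ⟨fun i => a * mk (w.take i), w.length, ?_, ?_, fun i => ?_, fun i hi => ?_,
    by rw [wd, FreeGroup.norm]⟩
  · simp [← FreeGroup.one_eq_mk]
  · simp [hw, mk_toWord]
  · have : (a * mk (w.take i))⁻¹ * (a * mk (w.take (i + 1))) = mk ((w.drop i).take 1) := by
      rw [show w.take (i + 1) = w.take i ++ (w.drop i).take 1 by rw [List.take_add], ← mul_mk]
      group
    rw [wd, this]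
    have := norm_mk_le (L₁ := (w.drop i).take 1)
    have h1 : ((w.drop i).take 1).length ≤ 1 := by simp
    exact_mod_cast this.trans h1
  · have hsplit : w.take i ++ w.drop i = w := List.take_append_drop i w
    have hr' : IsReduced (w.take i ++ w.drop i) := hsplit.symm ▸ hr
    have h1 : wd a (a * mk (w.take i)) = (w.take i).length := by
      rw [← norm_mk_of_isReduced (List.isChain_append.1 hr').1, wd]; simp
    have h2 : wd (a * mk (w.take i)) b = (w.drop i).length := by
      rw [← norm_mk_of_isReduced (List.isChain_append.1 hr').2.1, wd, hb]
      conv_lhs => rw [← hsplit, ← mul_mk, List.take_append_drop]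
      congr 2; group
    have h3 : wd a b = w.length := by rw [wd, FreeGroup.norm]
    rw [ex, h1, h2, h3, List.length_take, List.length_drop]
    omega

/-- A path with steps of length at most `L` passes within `L` of every point of the geodesic
between its endpoints. -/
lemma exists_wd_le_of_path {s : ℕ → FreeGroup α} {n : ℕ} {L : ℤ} (hL : 0 ≤ L)
    (hs : ∀ i < n, wd (s i) (s (i + 1)) ≤ L) {m : FreeGroup α} (hm : ex (s 0) m (s n) = 0) :
    ∃ i ≤ n, wd (s i) m ≤ L := by
  induction n with
  | zero =>
    refine ⟨0, le_rfl, ?_⟩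
    have h₁ := wd_self (s 0)
    have h₂ := wd_comm m (s 0)
    have h₃ := wd_nonneg (s 0) m
    unfold ex at hm; omega
  | succ n ih =>
    rcases ex_eq_zero_split hm (s n) with h | h
    · obtain ⟨i, hi, h⟩ := ih (fun i hi => hs i (by omega)) h
      exact ⟨i, by omega, h⟩
    · refine ⟨n, by omega, ?_⟩
      have h₁ := hs n (by omega)
      have h₂ := wd_nonneg m (s (n + 1))
      unfold ex at h; omega

/-- Geodesics are convex. -/
lemma ex_eq_zero_of_mem {a b s t p : FreeGroup α} (hs : ex a s b = 0) (ht : ex a t b = 0)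
    (hp : ex s p t = 0) : ex a p b = 0 := by
  have trans : ∀ {a b s p : FreeGroup α}, ex a s b = 0 → ex a p s = 0 → ex a p b = 0 := by
    intro a b s p h₁ h₂
    have h₃ := wd_triangle p s b
    have h₄ := ex_nonneg a p b
    unfold ex at *; omega
  have trans' : ∀ {a b s p : FreeGroup α}, ex a s b = 0 → ex s p b = 0 → ex a p b = 0 := by
    intro a b s p h₁ h₂
    rw [ex_comm] at h₁ h₂ ⊢
    exact trans h₁ h₂
  rcases ex_eq_zero_split hs t with h | h
  · have : ex a p t = 0 := trans' h hp
    exact trans ht this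
  · rw [ex_comm] at hp
    exact trans' ht (trans h hp)

/-- A point on the axis of `G`. -/
def IsAxisPoint (G y : FreeGroup α) : Prop := IsCyclicallyReduced (y⁻¹ * G * y).toWord

lemma conj_pow_eq {F : Type*} [Group F] (G y : F) (N : ℕ) : y⁻¹ * (G ^ N * y) = (y⁻¹ * G * y) ^ N := by
  have := conj_pow (a := y⁻¹) (b := G) (i := N)
  simp only [inv_inv] at this
  rw [this, mul_assoc]

lemma norm_pow_of_isCyclicallyReduced {v : List (α × Bool)} (hv : IsCyclicallyReduced v)
    (N : ℕ) : (mk v ^ N).norm = N * v.length := by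
  rw [FreeGroup.norm, toWord_pow, toWord_mk, hv.isReduced.reduce_eq,
    (hv.flatten_replicate N).isReduced.reduce_eq]
  simp

lemma IsAxisPoint.wd_pow {G y : FreeGroup α} (h : IsAxisPoint G y) (N : ℕ) :
    wd y (G ^ N * y) = N * wd y (G * y) := by
  rw [wd, conj_pow_eq, ← mk_toWord (x := y⁻¹ * G * y), norm_pow_of_isCyclicallyReduced h, wd,
    FreeGroup.norm, ← mul_assoc]
  push_cast; rfl

lemma IsAxisPoint.pow_mul {G y : FreeGroup α} (h : IsAxisPoint G y) (i : ℕ) :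
    IsAxisPoint G (G ^ i * y) := by
  unfold IsAxisPoint at *
  convert h using 2
  have : G ^ i * G = G * G ^ i := by rw [← pow_succ, ← pow_succ']
  calc (G ^ i * y)⁻¹ * G * (G ^ i * y) = y⁻¹ * (G ^ i)⁻¹ * (G * G ^ i) * y := by group
    _ = _ := by rw [← this]; group

lemma IsAxisPoint.inv {G y : FreeGroup α} (h : IsAxisPoint G y) : IsAxisPoint G⁻¹ y := by
  unfold IsAxisPoint at *
  rw [show y⁻¹ * G⁻¹ * y = (y⁻¹ * G * y)⁻¹ by group, toWord_inv]
  refine ⟨isReduced_invRev h.1, fun a ha b hb hab => ?_⟩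
  have h2 := h.2 (b.1, !b.2) (by
    simp only [invRev, List.head?_reverse, List.getLast?_map, Option.mem_def,
      Option.map_eq_some_iff] at hb
    obtain ⟨c, hc, rfl⟩ := hb
    simpa using hc) (a.1, !a.2) (by
    simp only [invRev, List.getLast?_reverse, List.head?_map, Option.mem_def,
      Option.map_eq_some_iff] at ha
    obtain ⟨c, hc, rfl⟩ := ha
    simpa using hc) hab.symm
  simpa using h2.symm

lemma IsAxisPoint.wd_pow_pow {G y : FreeGroup α} (h : IsAxisPoint G y) {i j : ℕ} (hij : i ≤ j) :
    wd (G ^ i * y) (G ^ j * y) = ((j : ℤ) - i) * wd y (G * y) := by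
  obtain ⟨k, rfl⟩ := Nat.exists_eq_add_of_le hij
  rw [pow_add, mul_assoc, wd_mul_left, h.wd_pow]
  push_cast; ring

lemma IsAxisPoint.ex_pow {G y : FreeGroup α} (h : IsAxisPoint G y) {i N : ℕ} (hi : i ≤ N) :
    ex y (G ^ i * y) (G ^ N * y) = 0 := by
  rw [ex, h.wd_pow, h.wd_pow_pow hi, h.wd_pow]; ring

lemma wd_pos_of_ne_one {G : FreeGroup α} (hG : G ≠ 1) (y : FreeGroup α) : 1 ≤ wd y (G * y) := by
  have h₁ := wd_nonneg y (G * y)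
  have h₂ : wd y (G * y) ≠ 0 := by
    rw [Ne, wd_eq_zero]; simpa using hG
  omega

/-- The projection of a point to the axis of `G`. -/
lemma exists_axisPoint (G y : FreeGroup α) :
    ∃ c, IsAxisPoint G c ∧ 2 * wd y c = ex (G⁻¹ * y) y (G * y) ∧ ex y c (G * y) = 0 ∧
      wd y (G * y) = wd c (G * c) + 2 * wd y c := by
  set w := (y⁻¹ * G * y).toWord with hw
  have hred : IsReduced w := isReduced_toWord
  set p := reduceCyclically.conjugator w with hp
  set v := reduceCyclically w with hv
  have hvc : IsCyclicallyReduced v := reduceCyclically.isCyclicallyReduced hred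
  have hdec : p ++ v ++ invRev p = w := reduceCyclically.conj_conjugator_reduceCyclically w
  have hmkw : mk w = y⁻¹ * G * y := by rw [hw, mk_toWord]
  have hconj : mk w = mk p * mk v * (mk p)⁻¹ := by
    rw [inv_mk, mul_mk, mul_mk, hdec]
  have hpr : IsReduced p := (List.isChain_append.1 (List.isChain_append.1 (hdec ▸ hred)).1).1
  have hGc : (y * mk p)⁻¹ * G * (y * mk p) = mk v := by
    rw [show (y * mk p)⁻¹ * G * (y * mk p) = (mk p)⁻¹ * (y⁻¹ * G * y) * mk p by group,
      ← hmkw, hconj]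
    group
  have d₁ : wd y (y * mk p) = p.length := by
    rw [wd, inv_mul_cancel_left, norm_mk_of_isReduced hpr]
  have d₂ : wd y (G * y) = 2 * p.length + v.length := by
    rw [wd, ← mul_assoc, FreeGroup.norm, ← hw, ← hdec]
    simp [invRev_length]; ring
  have d₃ : wd (y * mk p) (G * (y * mk p)) = v.length := by
    rw [wd, ← mul_assoc, hGc, norm_mk_of_isReduced hvc.isReduced]
  have d₄ : wd (y * mk p) (G * y) = p.length + v.length := by
    have : (y * mk p)⁻¹ * (G * y) = mk (v ++ invRev p) := by
      rw [← mul_mk, ← inv_mk, ← hGc]; group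
    rw [wd, this, norm_mk_of_isReduced]
    · simp [invRev_length]; ring
    · rw [List.append_assoc] at hdec
      exact (List.isChain_append.1 (hdec ▸ hred)).2.1
  have d₅ : wd (G⁻¹ * y) (G * y) = 2 * p.length + 2 * v.length := by
    have : (G⁻¹ * y)⁻¹ * (G * y) = (y⁻¹ * G * y) ^ 2 := by
      rw [sq]; group
    rw [wd, this, FreeGroup.norm, toWord_pow, ← hw, show 2 = 1 + 1 from rfl,
      reduceCyclically.reduce_flatten_replicate_succ hred]
    simp [invRev_length, ← hp, ← hv, List.replicate_succ]; ring
  have d₆ : wd (G⁻¹ * y) y = wd y (G * y) := by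
    rw [← wd_mul_left G]; simp
  refine ⟨y * mk p, ?_, ?_, ?_, ?_⟩
  · rw [IsAxisPoint, hGc, toWord_mk, hvc.isReduced.reduce_eq]; exact hvc
  · rw [ex, d₁, d₅, d₆, d₂]; ring
  · rw [ex, d₁, d₂, d₄]; ring
  · rw [d₁, d₂, d₃]; ring

/-- Displacement on the axis is minimal in the conjugacy class. -/
lemma IsAxisPoint.wd_le_norm_conj {G y : FreeGroup α} (h : IsAxisPoint G y) (g : FreeGroup α) :
    wd y (G * y) ≤ (g * G * g⁻¹).norm := by
  have key : ∀ N : ℕ, (N : ℤ) * wd y (G * y) ≤ 2 * wd y g⁻¹ + N * (g * G * g⁻¹).norm := by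
    intro N
    rw [← h.wd_pow]
    have h₁ := wd_triangle y g⁻¹ (G ^ N * y)
    have h₂ := wd_triangle g⁻¹ (G ^ N * g⁻¹) (G ^ N * y)
    rw [wd_mul_left, wd_comm _ y] at h₂
    have h₃ : wd g⁻¹ (G ^ N * g⁻¹) ≤ N * (g * G * g⁻¹).norm := by
      have : wd g⁻¹ (G ^ N * g⁻¹) = ((g * G * g⁻¹) ^ N).norm := by
        rw [wd, conj_pow_eq]; simp
      rw [this]
      clear h₁ h₂ this
      induction N with
      | zero => simp
      | succ N ih =>
        have := norm_mul_le ((g * G * g⁻¹) ^ N) (g * G * g⁻¹)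
        rw [← pow_succ] at this
        have : ((((g * G * g⁻¹) ^ (N + 1)).norm : ℕ) : ℤ) ≤
          ((g * G * g⁻¹) ^ N).norm + (g * G * g⁻¹).norm := by exact_mod_cast this
        push_cast; linarith
    omega
  by_contra! hlt
  have := key (2 * wd y g⁻¹ + 1).toNat
  have h₄ := wd_nonneg y g⁻¹
  rw [Int.toNat_of_nonneg (by omega)] at this
  nlinarith

end TreeMetric

end GrowthRate

namespace GrowthRate

open FreeGroup

section Cancellation

variable {α β : Type*} [DecidableEq α] [DecidableEq β]

lemma norm_map_le {f : FreeGroup α →* FreeGroup β} {L : ℕ} (hL : ∀ a, (f (of a)).norm ≤ L)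
    (x : FreeGroup α) : (f x).norm ≤ L * x.norm := by
  rw [FreeGroup.norm.eq_def x]
  conv_lhs => rw [← mk_toWord (x := x)]
  induction x.toWord with
  | nil => simp [← FreeGroup.one_eq_mk]
  | cons p l ih =>
    obtain ⟨a, b⟩ := p
    have h₁ : (f (mk [(a, b)])).norm = (f (of a)).norm := by
      cases b
      · rw [show mk [(a, false)] = (of a)⁻¹ by simp [of, inv_mk, invRev], _root_.map_inv, norm_inv_eq]
      · rfl
    have h₂ : mk ((a, b) :: l) = mk [(a, b)] * mk l := by rw [mul_mk]; rfl
    have := norm_mul_le (f (mk [(a, b)])) (f (mk l))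
    rw [← _root_.map_mul, ← h₂] at this
    have := hL a
    rw [List.length_cons, mul_add]
    omega

lemma exists_norm_map_le [Fintype α] (f : FreeGroup α →* FreeGroup β) :
    ∃ L : ℕ, ∀ x, (f x).norm ≤ L * x.norm :=
  ⟨∑ a, (f (of a)).norm, norm_map_le fun a => Finset.single_le_sum
    (f := fun a => (f (of a)).norm) (fun _ _ => Nat.zero_le _) (Finset.mem_univ a)⟩

lemma exists_wd_map_le [Fintype α] (f : FreeGroup α →* FreeGroup β) :
    ∃ L : ℕ, ∀ x y, wd (f x) (f y) ≤ L * wd x y := by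
  obtain ⟨L, hL⟩ := exists_norm_map_le f
  refine ⟨L, fun x y => ?_⟩
  have := hL (x⁻¹ * y)
  rw [_root_.map_mul, _root_.map_inv] at this
  simp only [wd]
  exact_mod_cast this

/-- Bounded cancellation. -/
lemma exists_ex_map_le [Fintype α] (f : FreeGroup α ≃* FreeGroup α) :
    ∃ C : ℕ, ∀ a y b, ex a y b = 0 → ex (f a) (f y) (f b) ≤ 2 * C := by
  obtain ⟨L, hL⟩ := exists_wd_map_le f.toMonoidHom
  obtain ⟨L', hL'⟩ := exists_wd_map_le f.symm.toMonoidHom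
  replace hL : ∀ x y, wd (f x) (f y) ≤ L * wd x y := hL
  replace hL' : ∀ x y, wd x y ≤ L' * wd (f x) (f y) := fun x y => by
    simpa using hL' (f x) (f y)
  have path : ∀ a y m, ex (f a) m (f y) = 0 →
      ∃ u, ex a u y = 0 ∧ wd (f u) m ≤ L := by
    intro a y m hm
    obtain ⟨s, n, rfl, rfl, hs, hsy, -⟩ := exists_geodesic a y
    obtain ⟨i, hi, h⟩ := exists_wd_le_of_path (s := fun i => f (s i)) (n := n) (L := L)
      (by positivity) (fun i _ => (hL _ _).trans (by
        have := hs i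
        nlinarith)) hm
    exact ⟨s i, hsy i hi, h⟩
  refine ⟨L * (L' * (2 * L)) + L, fun a y b hy => ?_⟩
  obtain ⟨m, h₁, h₂, h₃⟩ := exists_median (f a) (f b) (f y)
  obtain ⟨u, hu, hum⟩ := path a y m h₃
  obtain ⟨v, hv, hvm⟩ := path b y m h₂
  have huv : ex u y v = 0 := by
    have t₁ := wd_triangle a u v
    have t₂ := wd_triangle a v b
    have t₃ := ex_nonneg u y v
    have t₄ := wd_comm v y
    have t₅ := wd_comm b v
    have t₆ := wd_comm b y
    unfold ex at *; omega
  have k₁ : wd (f u) (f v) ≤ 2 * L := by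
    have := wd_triangle (f u) m (f v)
    rw [wd_comm m] at this
    omega
  have k₂ : wd u y ≤ L' * (2 * L) := by
    have h := hL' u v
    have h' := wd_nonneg y v
    have : (L' : ℤ) * wd (f u) (f v) ≤ L' * (2 * L) := by gcongr
    unfold ex at huv; omega
  have k₃ : wd (f u) (f y) ≤ L * (L' * (2 * L)) := (hL _ _).trans (by gcongr)
  have k₄ := wd_triangle (f y) (f u) m
  have k₅ := wd_comm (f y) (f u)
  have k₆ := wd_comm (f y) m
  have k₇ := wd_comm (f y) (f b)
  have k₈ := wd_comm (f b) m
  unfold ex at *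
  push_cast
  generalize (L : ℤ) * (L' * (2 * L)) = K at *
  omega

lemma ex_eq_zero_of_near {a b c e p : FreeGroup α} (h : ex c p e = 0)
    (hc : ex a c b ≤ 2 * wd c p) (he : ex a e b ≤ 2 * wd p e) : ex a p b = 0 := by
  by_contra hne
  have h₁ := ex_eq_zero_split h a
  have h₂ := ex_eq_zero_split h b
  have h₃ := ex_nonneg a p b
  have h₄ := ex_min b p c a
  have h₅ := ex_min a p c b
  have h₆ := ex_min b p e a
  have h₇ := ex_min a p e b
  have h₈ := ex_nonneg c p a
  have h₉ := ex_nonneg c p b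
  have h₁₀ := ex_nonneg a p e
  have h₁₁ := ex_nonneg b p e
  have c₁ := wd_comm a p
  have c₂ := wd_comm c p
  have c₃ := wd_comm e p
  have c₄ := wd_comm b p
  have c₅ := wd_comm a c
  have c₆ := wd_comm b c
  have c₇ := wd_comm a e
  have c₈ := wd_comm b e
  have c₉ := wd_comm a b
  unfold ex at *
  omega

lemma ex_le_ex_add (a y b c : FreeGroup α) : ex a c b ≤ ex a y b + 2 * wd y c := by
  have h₁ := wd_triangle a y c
  have h₂ := wd_triangle c y b
  rw [wd_comm c y] at h₂
  unfold ex; omega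

lemma IsAxisPoint.ex_inv {G y : FreeGroup α} (h : IsAxisPoint G y) :
    ex (G⁻¹ * y) y (G * y) = 0 := by
  have := h.ex_pow (i := 1) (N := 2) (by norm_num)
  rw [← ex_mul_left G⁻¹] at this
  simpa [pow_succ, mul_assoc] using this

/-- Powers of an axis point lying in `[1, Φ ^ k q]` are bounded linearly in `k`. -/
lemma pow_le_of_ex_eq_zero {Φ : FreeGroup α ≃* FreeGroup α} {C : ℕ}
    (hC : ∀ a y b, ex a y b = 0 → ex (Φ.symm a) (Φ.symm y) (Φ.symm b) ≤ 2 * C)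
    (q : FreeGroup α) (k N : ℕ) (G y : FreeGroup α) (hG : G ≠ 1) (hy : IsAxisPoint G y)
    (h₀ : ex 1 y ((Φ ^ k) q) = 0) (h₁ : ex 1 (G ^ N * y) ((Φ ^ k) q) = 0) :
    N ≤ q.norm + 4 * C * k := by
  induction k generalizing N G y with
  | zero =>
    have t₁ := wd_triangle y 1 (G ^ N * y)
    have t₂ := wd_triangle y q (G ^ N * y)
    have t₃ := wd_comm y 1
    have t₄ := wd_comm q (G ^ N * y)
    have t₅ := hy.wd_pow N
    have t₆ := wd_pos_of_ne_one hG y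
    simp only [pow_zero, MulAut.one_apply] at h₀ h₁
    unfold ex at h₀ h₁
    rw [wd_one q] at h₀ h₁
    have : (N : ℤ) ≤ N * wd y (G * y) := by nlinarith
    omega
  | succ k ih =>
    by_cases hN : N < 4 * C
    · nlinarith
    set q' := (Φ ^ k) q with hq'
    have hq : (Φ ^ (k + 1)) q = Φ q' := by rw [pow_succ', MulAut.mul_apply]
    set G' := Φ.symm G with hG'
    set y' := Φ.symm y with hy'
    have hGne : G' ≠ 1 := by simpa [hG'] using hG
    have e₀ : ex 1 y' q' ≤ 2 * C := by simpa [hq] using hC _ _ _ h₀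
    have e₁ : ex 1 (G' ^ N * y') q' ≤ 2 * C := by simpa [hq] using hC _ _ _ h₁
    have e₂ : ex (G'⁻¹ * y') y' (G' * y') ≤ 2 * C := by simpa using hC _ _ _ hy.ex_inv
    obtain ⟨c, hc, hyc, -, -⟩ := exists_axisPoint G' y'
    have e₃ : ex 1 c q' ≤ 4 * C := by
      have := ex_le_ex_add 1 y' q' c
      omega
    have e₄ : ex 1 (G' ^ N * c) q' ≤ 4 * C := by
      have := ex_le_ex_add 1 (G' ^ N * y') q' (G' ^ N * c)
      rw [wd_mul_left] at this
      omega
    have hpos := wd_pos_of_ne_one hGne c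
    have inner : ∀ i, 2 * C ≤ i → i + 2 * C ≤ N → ex 1 (G' ^ i * c) q' = 0 := by
      intro i hi hiN
      refine ex_eq_zero_of_near (hc.ex_pow (i := i) (N := N) (by omega)) ?_ ?_
      · rw [hc.wd_pow]
        have : (2 * C : ℤ) ≤ i := by exact_mod_cast hi
        nlinarith
      · rw [hc.wd_pow_pow (by omega)]
        have : (2 * C : ℤ) ≤ N - i := by omega
        nlinarith
    have := ih (N - 4 * C) G' (G' ^ (2 * C) * c) hGne (hc.pow_mul _) (inner _ le_rfl (by omega))
      (by
        rw [← mul_assoc, ← pow_add]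
        exact inner _ (by omega) (by omega))
    rw [mul_add]
    omega

lemma two_mul_wd_le {G e t : FreeGroup α} (hG : G ≠ 1)
    (h₁ : wd e t ≤ wd (G⁻¹ * e) t) (h₂ : ex (G * e) e t = 0) : 2 * wd e t ≤ wd t (G * t) := by
  have k₁ := ex_min e (G * e) (G * t) t
  have k₂ : wd e (G * t) = wd (G⁻¹ * e) t := by rw [← wd_mul_left G (G⁻¹ * e)]; simp
  have k₃ := wd_mul_left G e t
  have k₄ := wd_pos_of_ne_one hG e
  have k₅ := wd_comm (G * e) e
  have k₆ := wd_comm (G * e) t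
  unfold ex at *
  omega

lemma wd_le_of_displacement_le_aux {Φ : FreeGroup α ≃* FreeGroup α} {C : ℕ}
    (hC : ∀ a y b, ex a y b = 0 → ex (Φ.symm a) (Φ.symm y) (Φ.symm b) ≤ 2 * C)
    (q : FreeGroup α) (k m : ℕ) (G c s t : FreeGroup α) (D : ℤ) (hG : G ≠ 1)
    (hs : ex 1 s ((Φ ^ k) q) = 0) (ht : ex 1 t ((Φ ^ k) q) = 0) (hc : IsAxisPoint G c)
    (hcD : wd c (G * c) ≤ D) (hsc : 2 * wd s c ≤ D) (het : 2 * wd (G ^ m * c) t ≤ D) :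
    wd s t ≤ (q.norm + 4 * C * k + 5) * D := by
  have ha := wd_pos_of_ne_one hG c
  obtain ⟨a, ha'⟩ := Int.eq_ofNat_of_zero_le (wd_nonneg c (G * c))
  obtain ⟨D, rfl⟩ := Int.eq_ofNat_of_zero_le (by omega : 0 ≤ D)
  rw [ha'] at ha hcD
  have hm := hc.wd_pow m
  have hst : wd s t ≤ D + m * a := by
    have t₁ := wd_triangle s c t
    have t₂ := wd_triangle c (G ^ m * c) t
    rw [ha'] at hm
    omega
  have ha0 : 0 < a := by omega
  have haD : a ≤ D := by omega
  set j := D / a + 1 with hj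
  have hj₁ : D ≤ j * a := by
    rw [hj, add_mul, one_mul]; exact (Nat.lt_div_mul_add ha0).le
  have hj₂ : j * a ≤ 2 * D := by
    have := Nat.div_mul_le_self D a
    rw [hj, add_mul, one_mul]; omega
  have key : (m : ℤ) ≤ q.norm + 4 * C * k + 2 * j := by
    by_cases hmj : m < 2 * j
    · have : (0 : ℤ) ≤ q.norm + 4 * C * k := by positivity
      omega
    have inner : ∀ i, j ≤ i → i + j ≤ m → ex 1 (G ^ i * c) ((Φ ^ k) q) = 0 := by
      intro i hi him
      refine ex_eq_zero_of_mem hs ht (ex_eq_zero_of_near (hc.ex_pow (i := i) (N := m)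
        (by omega)) ?_ ?_)
      · have := ex_le_ex_add s s t c
        rw [ex_left] at this
        rw [hc.wd_pow, ha']
        have h' : D ≤ i * a := hj₁.trans (by gcongr)
        have h'' : (D : ℤ) ≤ i * a := by exact_mod_cast h'
        linarith
      · have := ex_le_ex_add s t t (G ^ m * c)
        rw [ex_right, wd_comm t] at this
        rw [hc.wd_pow_pow (by omega), ha']
        have h' : D ≤ (m - i) * a := hj₁.trans (by gcongr; omega)
        have h'' : (D : ℤ) ≤ (m - i) * a := by
          zify [show i ≤ m by omega] at h'
          exact h'
        linarith
    have := pow_le_of_ex_eq_zero hC q k (m - 2 * j) G (G ^ j * c) hG (hc.pow_mul _)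
      (inner _ le_rfl (by omega))
      (by rw [← mul_assoc, ← pow_add]; exact inner _ (by omega) (by omega))
    zify [show 2 * j ≤ m by omega] at this
    linarith
  have hj₂' : (j : ℤ) * a ≤ 2 * D := by exact_mod_cast hj₂
  have hB : (0 : ℤ) ≤ q.norm + 4 * C * k := by positivity
  have haD' : (a : ℤ) ≤ D := by exact_mod_cast haD
  generalize (q.norm : ℤ) + 4 * C * k = B at *
  have h₁ : (m : ℤ) * a ≤ (B + 2 * j) * a := by gcongr
  have h₂ : B * a ≤ B * D := by gcongr
  linarith

/-- Two points of `[1, Φ ^ k q]` that are moved little by a common nontrivial element are close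
to each other. -/
lemma wd_le_of_displacement_le {Φ : FreeGroup α ≃* FreeGroup α} {C : ℕ}
    (hC : ∀ a y b, ex a y b = 0 → ex (Φ.symm a) (Φ.symm y) (Φ.symm b) ≤ 2 * C)
    (q : FreeGroup α) (k : ℕ) (G s t : FreeGroup α) (D : ℤ) (hG : G ≠ 1)
    (hs : ex 1 s ((Φ ^ k) q) = 0) (ht : ex 1 t ((Φ ^ k) q) = 0)
    (hsD : wd s (G * s) ≤ D) (htD : wd t (G * t) ≤ D) :
    wd s t ≤ (q.norm + 4 * C * k + 5) * D := by
  obtain ⟨c, hc, -, -, hsc⟩ := exists_axisPoint G s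
  have hc₀ := wd_nonneg c (G * c)
  have hc₁ := wd_nonneg s c
  obtain ⟨m, hm⟩ : ∃ m : ℤ, ∀ m' : ℤ, wd (G ^ m * c) t ≤ wd (G ^ m' * c) t := by
    refine ⟨Function.argmin (fun m : ℤ => (wd (G ^ m * c) t).toNat), fun m' => ?_⟩
    have := Function.argmin_le (fun m : ℤ => (wd (G ^ m * c) t).toNat) m'
    have h' := wd_nonneg (G ^ m' * c) t
    omega
  set e := G ^ m * c with he
  have hGe : G * e = G ^ (m + 1) * c := by
    rw [he, ← mul_assoc, add_comm, zpow_add, zpow_one]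
  have hGe' : G⁻¹ * e = G ^ (m - 1) * c := by
    rw [he, ← mul_assoc, sub_eq_add_neg, add_comm, zpow_add, zpow_neg, zpow_one]
  have hee : ex (G * e) e (G⁻¹ * e) = 0 := by
    have h := hc.ex_inv
    rw [← ex_mul_left (G ^ m), ex_comm] at h
    rw [hGe, hGe', he]
    convert h using 2
    · rw [zpow_add, zpow_one, mul_assoc]
    · rw [zpow_sub, zpow_one, mul_assoc]
  have het : 2 * wd e t ≤ D := by
    rcases ex_eq_zero_split hee t with h | h
    · exact (two_mul_wd_le hG (hGe' ▸ hm _) h).trans htD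
    · have : wd t (G⁻¹ * t) = wd t (G * t) := by
        rw [← wd_mul_left G, mul_inv_cancel_left, wd_comm]
      rw [← this] at htD
      refine (two_mul_wd_le (inv_ne_one.2 hG) ?_ ?_).trans htD
      · rw [inv_inv, hGe]; exact hm _
      · rwa [ex_comm]
  obtain ⟨m, rfl | rfl⟩ := Int.eq_nat_or_neg m
  · exact wd_le_of_displacement_le_aux hC q k m G c s t D hG hs ht hc (by omega) (by omega)
      (by simpa [he] using het)
  · have hc' : wd c (G⁻¹ * c) = wd c (G * c) := by
      rw [← wd_mul_left G, mul_inv_cancel_left, wd_comm]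
    exact wd_le_of_displacement_le_aux hC q k m G⁻¹ c s t D (inv_ne_one.2 hG) hs ht hc.inv
      (by omega) (by omega) (by simpa [he] using het)

end Cancellation

end GrowthRate

namespace GrowthRate

open FreeGroup Filter Topology

section CyclicLength

variable {n : ℕ}

lemma wd_mul_self_eq {α : Type*} [DecidableEq α] (y u : FreeGroup α) :
    wd u (y * u) = (u⁻¹ * y * u).norm := by
  rw [wd, mul_assoc]

lemma cyclicLength_le (y u : FreeGroup (Fin n)) : (cyclicLength y : ℤ) ≤ wd u (y * u) := by
  rw [wd_mul_self_eq]
  have : cyclicLength y ≤ (u⁻¹ * y * u).norm := Nat.sInf_le ⟨u⁻¹, by rw [inv_inv]⟩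
  exact_mod_cast this

lemma exists_norm_eq_cyclicLength (y : FreeGroup (Fin n)) :
    ∃ g, (g * y * g⁻¹).norm = cyclicLength y :=
  Nat.sInf_mem (s := {m : ℕ | ∃ g : FreeGroup (Fin n), FreeGroup.norm (g * y * g⁻¹) = m})
    ⟨_, 1, rfl⟩

lemma one_le_cyclicLength {y : FreeGroup (Fin n)} (hy : y ≠ 1) : 1 ≤ cyclicLength y := by
  obtain ⟨g, hg⟩ := exists_norm_eq_cyclicLength y
  rw [← hg, Nat.one_le_iff_ne_zero, Ne, FreeGroup.norm_eq_zero]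
  simpa using hy

lemma cyclicLength_conj_le (g y : FreeGroup (Fin n)) :
    cyclicLength (g * y * g⁻¹) ≤ cyclicLength y := by
  obtain ⟨h, hh⟩ := exists_norm_eq_cyclicLength y
  rw [← hh]
  exact Nat.sInf_le ⟨h * g⁻¹, by congr 1; group⟩

lemma cyclicLength_conj (g y : FreeGroup (Fin n)) :
    cyclicLength (g * y * g⁻¹) = cyclicLength y := by
  refine le_antisymm (cyclicLength_conj_le g y) ?_
  have := cyclicLength_conj_le g⁻¹ (g * y * g⁻¹)
  rwa [show g⁻¹ * (g * y * g⁻¹) * g⁻¹⁻¹ = y by group] at this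

lemma exists_cyclicLength_eq_norm_map (f : FreeGroup (Fin n) →* FreeGroup (Fin n))
    (y : FreeGroup (Fin n)) :
    ∃ w, w.norm = cyclicLength y ∧ cyclicLength (f w) = cyclicLength (f y) := by
  obtain ⟨g, hg⟩ := exists_norm_eq_cyclicLength y
  refine ⟨_, hg, ?_⟩
  rw [_root_.map_mul, _root_.map_mul, _root_.map_inv, cyclicLength_conj]

end CyclicLength

section Displacement

variable {α : Type*} [DecidableEq α]

lemma wd_map_mul_le {f : FreeGroup α →* FreeGroup α} {v : FreeGroup α} {L : ℕ}
    (h : ∀ a, wd v (f (of a) * v) ≤ L) (w : FreeGroup α) : wd v (f w * v) ≤ L * w.norm := by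
  have hconj : ∀ w, wd v (f w * v) = (((MulAut.conj v⁻¹).toMonoidHom.comp f) w).norm := by
    intro w
    rw [wd_mul_self_eq]
    simp
  rw [hconj]
  have := norm_map_le (f := (MulAut.conj v⁻¹).toMonoidHom.comp f) (L := L)
    (fun a => by have := h a; rw [hconj] at this; exact_mod_cast this) w
  exact_mod_cast this

/-- The least `m` such that some point is moved at most `m` by the images of all generators. -/
noncomputable def minDisplacement (f : FreeGroup α →* FreeGroup α) : ℕ :=
  sInf {m : ℕ | ∃ u, ∀ a, wd u (f (of a) * u) ≤ m}

lemma exists_minDisplacement [Fintype α] (f : FreeGroup α →* FreeGroup α) :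
    ∃ u, ∀ a, wd u (f (of a) * u) ≤ minDisplacement f := by
  obtain ⟨L, hL⟩ := exists_norm_map_le f
  refine Nat.sInf_mem (s := {m : ℕ | ∃ u, ∀ a, wd u (f (of a) * u) ≤ m}) ⟨L, 1, fun a => ?_⟩
  rw [mul_one, wd_one]
  have := hL (of a)
  rw [norm_of, mul_one] at this
  exact_mod_cast this

lemma minDisplacement_le (f : FreeGroup α →* FreeGroup α) {u : FreeGroup α} {m : ℕ}
    (h : ∀ a, wd u (f (of a) * u) ≤ m) : minDisplacement f ≤ m :=
  Nat.sInf_le ⟨u, h⟩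

lemma one_le_minDisplacement [Fintype α] [Nonempty α] (f : FreeGroup α ≃* FreeGroup α) :
    1 ≤ minDisplacement f.toMonoidHom := by
  obtain ⟨u, hu⟩ := exists_minDisplacement f.toMonoidHom
  let a := Classical.arbitrary α
  have h₁ : f (of a) ≠ 1 := by simp
  have h₂ := (wd_pos_of_ne_one h₁ u).trans (hu a)
  exact_mod_cast h₂

lemma minDisplacement_comp_le [Fintype α] (f g : FreeGroup α →* FreeGroup α) :
    minDisplacement (f.comp g) ≤ minDisplacement g * minDisplacement f := by
  obtain ⟨u, hu⟩ := exists_minDisplacement g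
  obtain ⟨v, hv⟩ := exists_minDisplacement f
  refine minDisplacement_le (u := f u * v) _ fun a => ?_
  have h₁ := wd_map_mul_le hv (u⁻¹ * g (of a) * u)
  have h₂ := hu a
  rw [wd_mul_self_eq] at h₂
  have h₃ : wd (f u * v) ((f.comp g) (of a) * (f u * v)) =
      wd v (f (u⁻¹ * g (of a) * u) * v) := by
    rw [← wd_mul_left (f u) v]
    simp only [_root_.map_mul, _root_.map_inv, MonoidHom.comp_apply]
    congr 1
    group
  rw [h₃]
  push_cast
  nlinarith

end Displacement

/-- An ultrafilter together with an exponential rate: the scale at which a limiting tree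
is formed. -/
structure Scale where
  /-- The ultrafilter. -/
  ultrafilter : Ultrafilter ℕ
  /-- The exponential growth rate. -/
  rate : ℝ
  le_atTop : (ultrafilter : Filter ℕ) ≤ atTop
  rate_pos : 0 < rate

namespace Scale

variable {S : Scale} {f g : ℕ → ℤ}

/-- Sequences growing at a rate strictly smaller than the rate of the scale. -/
def Negl (S : Scale) (f : ℕ → ℤ) : Prop :=
  ∃ η > 0, ∀ᶠ k in (S.ultrafilter : Filter ℕ), (f k : ℝ) ≤ Real.exp ((S.rate - η) * k)

lemma Negl.mono (hf : S.Negl f) (h : ∀ k, g k ≤ f k) : S.Negl g := by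
  obtain ⟨η, hη, hf⟩ := hf
  exact ⟨η, hη, hf.mono fun k hk => (Int.cast_le.2 (h k)).trans hk⟩

lemma eventually_linear_le (A B : ℝ) {η : ℝ} (hη : 0 < η) :
    ∀ᶠ k : ℕ in atTop, A * k + B ≤ Real.exp (η * k) := by
  have h₁ : Tendsto (fun k : ℕ => (A * k + B) / Real.exp (η * k)) atTop (𝓝 0) := by
    have h₂ : Tendsto (fun x : ℝ => (A * x + B) * Real.exp (-(η * x))) atTop (𝓝 0) := by
      have k₁ : Tendsto (fun x : ℝ => η * x) atTop atTop := tendsto_id.const_mul_atTop hη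
      have k₂ := (Real.tendsto_pow_mul_exp_neg_atTop_nhds_zero 1).comp k₁
      have k₃ := (Real.tendsto_pow_mul_exp_neg_atTop_nhds_zero 0).comp k₁
      have k₄ := (k₂.const_mul (A / η)).add (k₃.const_mul B)
      rw [mul_zero, mul_zero, add_zero] at k₄
      refine k₄.congr fun x => ?_
      simp only [Function.comp, pow_one, pow_zero]
      field_simp
    refine (h₂.comp tendsto_natCast_atTop_atTop).congr fun k => ?_
    simp only [Function.comp, Real.exp_neg, div_eq_mul_inv]
  filter_upwards [h₁.eventually (gt_mem_nhds one_pos)] with k hk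
  rw [div_lt_one (Real.exp_pos _)] at hk
  exact hk.le

lemma Negl.linear_mul (hf : S.Negl f) {A B : ℤ} (hA : 0 ≤ A) (hB : 0 ≤ B) :
    S.Negl fun k => (A * k + B) * f k := by
  obtain ⟨η, hη, hf⟩ := hf
  refine ⟨η / 2, by positivity, ?_⟩
  filter_upwards [hf, S.le_atTop (eventually_linear_le A B (half_pos hη))] with k h₁ h₂
  push_cast
  have hA' : (0 : ℝ) ≤ A := by exact_mod_cast hA
  have hB' : (0 : ℝ) ≤ B := by exact_mod_cast hB
  calc ((A : ℝ) * k + B) * f k ≤ (A * k + B) * Real.exp ((S.rate - η) * k) := by gcongr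
    _ ≤ Real.exp (η / 2 * k) * Real.exp ((S.rate - η) * k) := by gcongr
    _ = Real.exp ((S.rate - η / 2) * k) := by rw [← Real.exp_add]; congr 1; ring

lemma Negl.const_mul (hf : S.Negl f) {B : ℤ} (hB : 0 ≤ B) : S.Negl fun k => B * f k := by
  simpa using hf.linear_mul le_rfl hB

lemma negl_const (S : Scale) (c : ℤ) : S.Negl fun _ => c := by
  refine ⟨S.rate / 2, half_pos S.rate_pos, ?_⟩
  filter_upwards [S.le_atTop (eventually_linear_le 0 c (half_pos S.rate_pos))] with k hk
  rw [zero_mul, zero_add] at hk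
  rwa [sub_half]

lemma Negl.max (hf : S.Negl f) (hg : S.Negl g) : S.Negl fun k => max (f k) (g k) := by
  obtain ⟨η, hη, hf⟩ := hf
  obtain ⟨θ, hθ, hg⟩ := hg
  refine ⟨min η θ, lt_min hη hθ, ?_⟩
  filter_upwards [hf, hg] with k h₁ h₂
  push_cast
  refine max_le (h₁.trans ?_) (h₂.trans ?_)
  · gcongr; exact min_le_left _ _
  · gcongr; exact min_le_right _ _

lemma Negl.add (hf : S.Negl f) (hg : S.Negl g) : S.Negl fun k => f k + g k :=
  ((hf.max hg).const_mul (B := 2) (by norm_num)).mono fun k => by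
    have h₁ := le_max_left (f k) (g k)
    have h₂ := le_max_right (f k) (g k)
    omega

lemma Negl.of_min (h : S.Negl fun k => min (f k) (g k)) : S.Negl f ∨ S.Negl g := by
  obtain ⟨η, hη, h⟩ := h
  have : ∀ᶠ k in (S.ultrafilter : Filter ℕ), (f k : ℝ) ≤ Real.exp ((S.rate - η) * k) ∨
      (g k : ℝ) ≤ Real.exp ((S.rate - η) * k) := by
    filter_upwards [h] with k hk
    push_cast at hk
    exact min_le_iff.1 hk
  rcases Ultrafilter.eventually_or.1 this with h | h
  exacts [Or.inl ⟨η, hη, h⟩, Or.inr ⟨η, hη, h⟩]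

lemma negl_sum {ι : Type*} (s : Finset ι) {f : ι → ℕ → ℤ} (h : ∀ i ∈ s, S.Negl (f i)) :
    S.Negl fun k => ∑ i ∈ s, f i k := by
  classical
  induction s using Finset.induction_on with
  | empty => simpa using S.negl_const 0
  | insert a s ha ih =>
    simp only [Finset.sum_insert ha]
    exact (h a (Finset.mem_insert_self _ _)).add
      (ih fun i hi => h i (Finset.mem_insert_of_mem hi))

lemma not_negl (h : ∀ k : ℕ, Real.exp (S.rate * k) ≤ f k) : ¬ S.Negl f := by
  rintro ⟨η, hη, hf⟩
  obtain ⟨k, h₁, h₂⟩ := (hf.and (S.le_atTop (eventually_ge_atTop 1))).exists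
  have h₃ := Real.exp_le_exp.1 ((h k).trans h₁)
  have h₄ : (1 : ℝ) ≤ k := by exact_mod_cast h₂
  nlinarith

end Scale

/-- Either the growth rate exists, or the conjugacy class grows, along some ultrafilter, slower
than the automorphism. -/
lemma growth_or_scale {n : ℕ} [NeZero n] (Φ : FreeGroup (Fin n) ≃* FreeGroup (Fin n))
    {x : FreeGroup (Fin n)} (hx : x ≠ 1) :
    (∃ lam : ℝ, 1 ≤ lam ∧ Tendsto
        (fun k : ℕ => (1 / (k : ℝ)) * Real.log (cyclicLength ((Φ ^ k) x)))
        atTop (𝓝 (Real.log lam))) ∨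
      ∃ S : Scale, (S.Negl fun k => cyclicLength ((Φ ^ k) x)) ∧
        ∀ (k : ℕ) u, ∃ i, Real.exp (S.rate * k) ≤ wd u ((Φ ^ k) (of i) * u) := by
  set M : ℕ → ℕ := fun k => minDisplacement (Φ ^ k).toMonoidHom with hM
  have hM1 : ∀ k, (1 : ℝ) ≤ M k := fun k => by exact_mod_cast one_le_minDisplacement (Φ ^ k)
  have hMmul : ∀ k j, M (k + j) ≤ M k * M j := by
    intro k j
    have := minDisplacement_comp_le (Φ ^ j).toMonoidHom (Φ ^ k).toMonoidHom
    rwa [show (Φ ^ j).toMonoidHom.comp (Φ ^ k).toMonoidHom = (Φ ^ (k + j)).toMonoidHom by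
      rw [add_comm, pow_add]; rfl] at this
  have hsub : Subadditive fun k => Real.log (M k) := by
    intro k j
    have h₁ := hM1 k
    have h₂ := hM1 j
    have h₃ := hM1 (k + j)
    rw [← Real.log_mul (by positivity) (by positivity)]
    refine Real.log_le_log (by positivity) ?_
    exact_mod_cast hMmul k j
  have hnn : ∀ k : ℕ, 0 ≤ Real.log (M k) / k := fun k =>
    div_nonneg (Real.log_nonneg (hM1 k)) (Nat.cast_nonneg k)
  have hbdd : BddBelow (Set.range fun k : ℕ => Real.log (M k) / k) :=
    ⟨0, by rintro _ ⟨k, rfl⟩; exact hnn k⟩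
  have hlim := hsub.tendsto_lim hbdd
  set l := hsub.lim with hl
  have hl0 : 0 ≤ l := ge_of_tendsto' hlim hnn
  have hMl : ∀ k : ℕ, Real.exp (l * k) ≤ M k := by
    intro k
    rcases Nat.eq_zero_or_pos k with rfl | hk
    · simpa using hM1 0
    · have h₁ := hsub.lim_le_div hbdd hk.ne'
      have h₂ : (0 : ℝ) < k := by exact_mod_cast hk
      rw [le_div_iff₀ h₂] at h₁
      rw [← Real.le_log_iff_exp_le (by linarith [hM1 k])]
      exact h₁
  have ha1 : ∀ k, (1 : ℝ) ≤ cyclicLength ((Φ ^ k) x) := fun k => by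
    exact_mod_cast one_le_cyclicLength (by simpa using hx)
  have hN : (1 : ℝ) ≤ cyclicLength x := by exact_mod_cast one_le_cyclicLength hx
  have haM : ∀ k, (cyclicLength ((Φ ^ k) x) : ℝ) ≤ M k * cyclicLength x := by
    intro k
    obtain ⟨w, hw, hwx⟩ := exists_cyclicLength_eq_norm_map (Φ ^ k).toMonoidHom x
    obtain ⟨u, hu⟩ := exists_minDisplacement (Φ ^ k).toMonoidHom
    have := (cyclicLength_le _ u).trans (wd_map_mul_le hu w)
    rw [hwx, hw] at this
    exact_mod_cast this
  by_cases H : ∃ η > 0, ∃ᶠ k : ℕ in atTop,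
      (cyclicLength ((Φ ^ k) x) : ℝ) ≤ Real.exp ((l - η) * k)
  · right
    obtain ⟨η, hη, H⟩ := H
    set s := {k : ℕ | (cyclicLength ((Φ ^ k) x) : ℝ) ≤ Real.exp ((l - η) * k)} with hs
    have : NeBot (atTop ⊓ 𝓟 s) := frequently_mem_iff_neBot.1 H
    have hle := Ultrafilter.of_le (atTop ⊓ 𝓟 s)
    have hle' := hle.trans inf_le_left
    have hmem : ∀ᶠ k in (Ultrafilter.of (atTop ⊓ 𝓟 s) : Filter ℕ), k ∈ s :=
      (hle.trans inf_le_right) (mem_principal_self s)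
    have hlη : η ≤ l := by
      obtain ⟨k, h₁, h₂⟩ := (hmem.and (hle' (eventually_ge_atTop 1))).exists
      have h₃ := (ha1 k).trans h₁
      rw [← Real.exp_zero, Real.exp_le_exp] at h₃
      have h₄ : (0 : ℝ) < k := by exact_mod_cast h₂
      nlinarith [nonneg_of_mul_nonneg_left h₃ h₄]
    refine ⟨⟨_, l, hle', hη.trans_le hlη⟩, ⟨η, hη, ?_⟩, fun k u => ?_⟩
    · exact hmem.mono fun k hk => by exact_mod_cast hk
    · by_contra! hcon
      simp only at hcon
      set m := Finset.univ.sup' Finset.univ_nonempty fun i =>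
        ((u⁻¹ * (Φ ^ k) (of i) * u).norm) with hm
      obtain ⟨i, -, hi⟩ := Finset.exists_mem_eq_sup' Finset.univ_nonempty fun i =>
        ((u⁻¹ * (Φ ^ k) (of i) * u).norm)
      have h₁ : M k ≤ m := minDisplacement_le _ (u := u) fun a => by
        change wd u ((Φ ^ k) (of a) * u) ≤ m
        rw [wd_mul_self_eq]
        exact_mod_cast Finset.le_sup' (fun i => ((u⁻¹ * (Φ ^ k) (of i) * u).norm))
          (Finset.mem_univ a)
      have h₂ := hcon i
      rw [wd_mul_self_eq] at h₂
      rw [hm, hi] at h₁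
      have h₃ : (M k : ℝ) ≤ ((u⁻¹ * (Φ ^ k) (of i) * u).norm : ℕ) := by exact_mod_cast h₁
      have h₄ := hMl k
      push_cast at h₂
      linarith
  · left
    push Not at H
    refine ⟨Real.exp l, Real.one_le_exp hl0, ?_⟩
    rw [Real.log_exp]
    have hup : Tendsto (fun k : ℕ => Real.log (M k) / k + Real.log (cyclicLength x) / k) atTop
        (𝓝 l) := by
      simpa using hlim.add (tendsto_const_div_atTop_nhds_zero_nat (Real.log (cyclicLength x)))
    refine tendsto_order.2 ⟨fun b hb => ?_, fun b hb => ?_⟩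
    · filter_upwards [H (l - b) (sub_pos.2 hb), eventually_ge_atTop 1] with k h₁ h₂
      have h₄ : (0 : ℝ) < k := by exact_mod_cast h₂
      rw [sub_sub_cancel, ← Real.lt_log_iff_exp_lt (by linarith [ha1 k])] at h₁
      rw [one_div, inv_mul_eq_div, lt_div_iff₀ h₄]
      exact h₁
    · filter_upwards [hup.eventually (gt_mem_nhds hb)] with k h₁
      refine lt_of_le_of_lt ?_ h₁
      rw [one_div, inv_mul_eq_div, ← add_div,
        ← Real.log_mul (by linarith [hM1 k]) (by linarith)]
      exact div_le_div_of_nonneg_right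
        (Real.log_le_log (by linarith [ha1 k]) (haM k)) (Nat.cast_nonneg k)

end GrowthRate

namespace GrowthRate

/-- Betweenness relations of median pretrees. -/
structure IsPretree {T : Type*} (B : T → T → T → Prop) : Prop where
  left : ∀ a b, B a a b
  symm : ∀ {a x b}, B a x b → B b x a
  eq_of_self : ∀ {a x}, B a x a → x = a
  split : ∀ {a x b}, B a x b → ∀ c, B a x c ∨ B c x b
  antisymm : ∀ {a x b}, B a x b → B a b x → x = b
  median : ∀ a b c, ∃ m, B a m b ∧ B b m c ∧ B a m c

section Pretree

variable {T : Type*} {B : T → T → T → Prop}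

/-- `m` is a median of `a`, `b`, `c`. -/
def IsMedian (B : T → T → T → Prop) (a b c m : T) : Prop := B a m b ∧ B b m c ∧ B a m c

namespace IsPretree

lemma right (h : IsPretree B) (a b : T) : B a b b := h.symm (h.left b a)

lemma trans (h : IsPretree B) {a s b p : T} (h₁ : B a s b) (h₂ : B a p s) : B a p b := by
  rcases h.split h₂ b with h₃ | h₃
  · exact h₃
  rcases h.split h₁ p with h₄ | h₄
  · rwa [h.antisymm h₂ h₄]
  · rwa [h.antisymm h₃ (h.symm h₄)]

lemma trans_right (h : IsPretree B) {a s b p : T} (h₁ : B a s b) (h₂ : B a p s) : B p s b := by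
  rcases h.split h₁ p with h₄ | h₄
  · rw [h.antisymm h₂ h₄]; exact h.left _ _
  · exact h₄

lemma comparable (h : IsPretree B) {r z z' a : T} (h₁ : B r z a) (h₂ : B r z' a) :
    B r z z' ∨ B r z' z := by
  rcases h.split h₁ z' with h₃ | h₃
  · exact Or.inl h₃
  · exact Or.inr (h.symm (h.trans_right (h.symm h₂) (h.symm h₃)))

lemma isMedian_unique (h : IsPretree B) {a b c m m' : T} (hm : IsMedian B a b c m)
    (hm' : IsMedian B a b c m') : m = m' := by
  obtain ⟨h₁, h₂, h₃⟩ := hm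
  obtain ⟨k₁, k₂, k₃⟩ := hm'
  have e₁ := h.split h₁ m'
  have e₂ := h.split h₂ m'
  have e₃ := h.split h₃ m'
  have f₁ := h.split k₁ m
  have f₂ := h.split k₂ m
  have f₃ := h.split k₃ m
  have q : ∀ {x}, B x m m' → B x m' m → m = m' := fun p q => h.antisymm p q
  have s : ∀ {a x b}, B a x b → B b x a := h.symm
  rcases e₁ with e₁ | e₁ <;> rcases e₂ with e₂ | e₂ <;> rcases e₃ with e₃ | e₃ <;>
  rcases f₁ with f₁ | f₁ <;> rcases f₂ with f₂ | f₂ <;> rcases f₃ with f₃ | f₃ <;>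
  first
    | exact q e₁ f₁ | exact q (s e₁) (s f₁) | exact q e₂ f₂ | exact q (s e₂) (s f₂)
    | exact q e₃ f₃ | exact q (s e₃) (s f₃) | exact q (s e₁) f₂ | exact q e₂ (s f₁)
    | exact q e₁ f₃ | exact q e₃ f₁ | exact q (s e₂) (s f₃) | exact q (s e₃) (s f₂)

lemma isMedian_swap (h : IsPretree B) {r a b m : T} (hm : IsMedian B r a b m) :
    IsMedian B r b a m := ⟨hm.2.2, h.symm hm.2.1, hm.1⟩

lemma isMedian_of_le (h : IsPretree B) {r a b : T} (hab : B r a b) : IsMedian B r a b a :=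
  ⟨h.right _ _, h.left _ _, hab⟩

lemma le_isMedian (h : IsPretree B) {r a b m z : T} (hm : IsMedian B r a b m) (ha : B r z a)
    (hb : B r z b) : B r z m := by
  rcases h.split ha m with h₁ | h₁
  · exact h₁
  rcases h.split hb m with h₂ | h₂
  · exact h₂
  rcases h.split hm.2.1 z with h₃ | h₃
  · rw [h.antisymm (h.symm h₁) h₃]; exact h.right _ _
  · rw [h.antisymm (h.symm h₂) (h.symm h₃)]; exact h.right _ _

lemma isMedian_meet (h : IsPretree B) {r a₁ a₂ a b m : T} (ha : IsMedian B r a₁ a₂ a)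
    (hm : IsMedian B r a b m) : m = a ∨ IsMedian B r a₂ b m := by
  obtain ⟨m', hm'⟩ := h.median r a₂ b
  change IsMedian B r a₂ b m' at hm'
  rcases h.comparable ha.2.2 hm'.1 with h₁ | h₁
  · exact Or.inl (h.isMedian_unique hm (h.isMedian_of_le (h.trans hm'.2.2 h₁)))
  · right
    have h₂ : B r m' m := h.le_isMedian hm h₁ hm'.2.2
    have h₃ : B r m m' := h.le_isMedian hm' (h.trans ha.2.2 hm.1) hm.2.2
    rwa [h.antisymm h₃ h₂]

end IsPretree

/-- A set containing the medians of its points. -/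
def MedianClosed (B : T → T → T → Prop) (A : Finset T) : Prop :=
  ∀ a ∈ A, ∀ b ∈ A, ∀ c ∈ A, ∀ m, IsMedian B a b c m → m ∈ A

lemma IsPretree.exists_medianClosed (h : IsPretree B) (W : Finset T) (hW : W.Nonempty) :
    ∃ V : Finset T, W ⊆ V ∧ MedianClosed B V ∧
      ∀ y ∈ V, y ∉ W → ∃ a ∈ V, ∃ b ∈ V, a ≠ y ∧ b ≠ y ∧ B a y b := by
  classical
  obtain ⟨r, hr⟩ := hW
  choose med hmed using fun p : T × T => h.median r p.1 p.2
  have hmed' : ∀ a b, IsMedian B r a b (med (a, b)) := fun a b => hmed (a, b)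
  set V := (W ×ˢ W).image med with hV
  have mem : ∀ {a b m}, a ∈ W → b ∈ W → IsMedian B r a b m → m ∈ V := by
    intro a b m ha hb hm
    rw [h.isMedian_unique hm (hmed' a b)]
    exact Finset.mem_image_of_mem _ (Finset.mem_product.2 ⟨ha, hb⟩)
  have mem' : ∀ {m}, m ∈ V → ∃ a ∈ W, ∃ b ∈ W, IsMedian B r a b m := by
    intro m hm
    obtain ⟨⟨a, b⟩, hab, rfl⟩ := Finset.mem_image.1 hm
    rw [Finset.mem_product] at hab
    exact ⟨a, hab.1, b, hab.2, hmed' a b⟩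
  have hWV : W ⊆ V := fun a ha => mem ha ha (h.isMedian_of_le (h.right _ _))
  have meet : ∀ {a b m}, a ∈ V → b ∈ V → IsMedian B r a b m → m ∈ V := by
    intro a b m ha hb hm
    obtain ⟨a₁, h₁, a₂, h₂, ha'⟩ := mem' ha
    obtain ⟨b₁, k₁, b₂, k₂, hb'⟩ := mem' hb
    rcases h.isMedian_meet ha' hm with rfl | hm
    · exact ha
    rcases h.isMedian_meet hb' (h.isMedian_swap hm) with rfl | hm
    · exact hb
    exact mem k₂ h₂ hm
  refine ⟨V, hWV, fun a ha b hb c hc m hm => ?_, fun y hy hyW => ?_⟩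
  · obtain ⟨h₁, h₂, h₃⟩ := hm
    rcases h.split h₁ r with e₁ | e₁
    · rcases h.split h₂ r with e₂ | e₂
      · exact meet ha hb ⟨h.symm e₁, h₁, h.symm e₂⟩
      · exact meet ha hc ⟨h.symm e₁, h₃, e₂⟩
    · rcases h.split h₃ r with e₂ | e₂
      · exact meet ha hb ⟨h.symm e₂, h₁, e₁⟩
      · exact meet hb hc ⟨e₁, h₂, e₂⟩
  · obtain ⟨a, ha, b, hb, hm⟩ := mem' hy
    refine ⟨a, hWV ha, b, hWV hb, ?_, ?_, hm.2.1⟩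
    · rintro rfl; exact hyW ha
    · rintro rfl; exact hyW hb

end Pretree

end GrowthRate

namespace GrowthRate

/-- Group actions on median pretrees with trivial arc stabilizers and no dilation. -/
structure IsTreeAction (G : Type*) {T : Type*} [Group G] [MulAction G T]
    (B : T → T → T → Prop) : Prop extends IsPretree B where
  smul : ∀ (g : G) {a x b}, B a x b → B (g • a) (g • x) (g • b)
  nodil : ∀ (g : G) {y w u}, g • y = y → B y w u → B y (g • w) u → g • w = w
  arc : ∀ (g : G) {a b : T}, g • a = a → g • b = b → a ≠ b → g = 1

section Directions

variable {G T : Type*} [Group G] [MulAction G T] {B : T → T → T → Prop}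

/-- Two points define the same direction at `y` if `y` does not separate them. -/
def dirSetoid (h : IsPretree B) : Setoid {p : T × T // p.1 ≠ p.2} where
  r p q := p.1.1 = q.1.1 ∧ ¬ B p.1.2 p.1.1 q.1.2
  iseqv :=
    { refl := fun p => ⟨rfl, fun hp => p.2 (h.eq_of_self hp)⟩
      symm := fun hpq => ⟨hpq.1.symm, fun hq => hpq.2 (hpq.1 ▸ h.symm hq)⟩
      trans := fun {_ q _} hpq hqs => ⟨hpq.1.trans hqs.1, fun hps =>
        (h.split hps q.1.2).elim hpq.2 (hpq.1 ▸ hqs.2)⟩ }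

/-- The directions of a tree. -/
def Dir (h : IsTreeAction G B) : Type _ := Quotient (dirSetoid h.toIsPretree)

/-- The direction at `y` pointing towards `a`. -/
def Dir.mk (h : IsTreeAction G B) (p : {p : T × T // p.1 ≠ p.2}) : Dir h :=
  Quotient.mk _ p

lemma Dir.mk_eq {h : IsTreeAction G B} {p q : {p : T × T // p.1 ≠ p.2}} :
    Dir.mk h p = Dir.mk h q ↔ p.1.1 = q.1.1 ∧ ¬ B p.1.2 p.1.1 q.1.2 :=
  Quotient.eq (r := dirSetoid h.toIsPretree)

/-- The base point of a direction. -/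
def Dir.base {h : IsTreeAction G B} : Dir h → T :=
  Quotient.lift (fun p => p.1.1) fun _ _ hpq => hpq.1

@[simp] lemma Dir.base_mk (h : IsTreeAction G B) (p : {p : T × T // p.1 ≠ p.2}) :
    (Dir.mk h p).base = p.1.1 := rfl

lemma IsTreeAction.smul_iff (h : IsTreeAction G B) (g : G) {a x b : T} :
    B (g • a) (g • x) (g • b) ↔ B a x b :=
  ⟨fun hb => by simpa using h.smul g⁻¹ hb, h.smul g⟩

/-- The action on pairs of distinct points. -/
def smulPair (g : G) (p : {p : T × T // p.1 ≠ p.2}) : {p : T × T // p.1 ≠ p.2} :=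
  ⟨(g • p.1.1, g • p.1.2), fun hp => p.2 (MulAction.injective g hp)⟩

instance (h : IsTreeAction G B) : MulAction G (Dir h) where
  smul g := Quotient.lift (fun p => Dir.mk h (smulPair g p)) fun p q hpq => by
    rw [Dir.mk_eq]
    exact ⟨congrArg (g • ·) hpq.1, fun hb => hpq.2 ((h.smul_iff g).1 hb)⟩
  one_smul d := by
    induction d using Quotient.inductionOn with
    | _ p =>
      change Dir.mk h (smulPair 1 p) = Dir.mk h p
      simp [smulPair]
  mul_smul g g' d := by
    induction d using Quotient.inductionOn with
    | _ p =>
      change Dir.mk h (smulPair (g * g') p) = Dir.mk h (smulPair g (smulPair g' p))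
      simp [smulPair, mul_smul]

lemma Dir.smul_mk (h : IsTreeAction G B) (g : G) (p : {p : T × T // p.1 ≠ p.2}) :
    g • Dir.mk h p = Dir.mk h (smulPair g p) := rfl

lemma Dir.exists_mk {h : IsTreeAction G B} (d : Dir h) : ∃ p, Dir.mk h p = d :=
  Quotient.exists_rep d

lemma Dir.base_smul {h : IsTreeAction G B} (g : G) (d : Dir h) : (g • d).base = g • d.base := by
  obtain ⟨p, rfl⟩ := d.exists_mk
  rfl

lemma Dir.eq_one_of_smul_eq {h : IsTreeAction G B} (g : G) (d : Dir h) (hd : g • d = d) :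
    g = 1 := by
  obtain ⟨⟨⟨y, a⟩, hya⟩, rfl⟩ := d.exists_mk
  rw [Dir.smul_mk, Dir.mk_eq] at hd
  obtain ⟨hy, hB⟩ := hd
  simp only [smulPair] at hy hB
  obtain ⟨w, h₁, h₂, h₃⟩ := h.median (g • a) y a
  have hw : y ≠ w := by
    rintro rfl
    rw [hy] at hB
    exact hB h₃
  have h₄ : B y (g • w) (g • a) := by
    have := h.smul g h₂
    rwa [hy] at this
  exact h.arc g hy (h.nodil g hy (h.symm h₁) h₄) hw

section Counting

variable [DecidableEq T]

open Classical in
/-- The directions defined by a finite set of points. -/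
noncomputable def dirs (h : IsTreeAction G B) (A : Finset T) : Finset (Dir h) :=
  ((A ×ˢ A).subtype fun p => p.1 ≠ p.2).image (Dir.mk h)

lemma mem_dirs {h : IsTreeAction G B} {A : Finset T} {d : Dir h} :
    d ∈ dirs h A ↔ ∃ y ∈ A, ∃ a ∈ A, ∃ hya : y ≠ a, Dir.mk h ⟨(y, a), hya⟩ = d := by
  simp only [dirs, Finset.mem_image, Finset.mem_subtype, Finset.mem_product]
  constructor
  · rintro ⟨⟨⟨y, a⟩, hya⟩, ⟨hy, ha⟩, rfl⟩
    exact ⟨y, hy, a, ha, hya, rfl⟩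
  · rintro ⟨y, hy, a, ha, hya, rfl⟩
    exact ⟨⟨(y, a), hya⟩, ⟨hy, ha⟩, rfl⟩

lemma dirs_mono {h : IsTreeAction G B} {A A' : Finset T} (hA : A ⊆ A') :
    dirs h A ⊆ dirs h A' := by
  intro d hd
  obtain ⟨y, hy, a, ha, hya, rfl⟩ := mem_dirs.1 hd
  exact mem_dirs.2 ⟨y, hA hy, a, hA ha, hya, rfl⟩

lemma base_mem_of_mem_dirs {h : IsTreeAction G B} {A : Finset T} {d : Dir h}
    (hd : d ∈ dirs h A) : d.base ∈ A := by
  obtain ⟨y, hy, a, ha, hya, rfl⟩ := mem_dirs.1 hd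
  exact hy

lemma smul_mem_dirs {h : IsTreeAction G B} {A A' : Finset T} (g : G)
    (hA : ∀ a ∈ A, g • a ∈ A') {d : Dir h} (hd : d ∈ dirs h A) : g • d ∈ dirs h A' := by
  obtain ⟨y, hy, a, ha, hya, rfl⟩ := mem_dirs.1 hd
  exact mem_dirs.2 ⟨g • y, hA _ hy, g • a, hA _ ha, fun e => hya (MulAction.injective g e), rfl⟩

/-- A median closed set with at least two points has a leaf, attached at another point. -/
lemma exists_leaf (h : IsPretree B) {A : Finset T} (hA : MedianClosed B A)
    (hcard : 2 ≤ A.card) :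
    ∃ l ∈ A, MedianClosed B (A.erase l) ∧ (∀ a ∈ A.erase l, ∀ b ∈ A.erase l, ¬ B a l b) ∧
      ∃ p ∈ A.erase l, ∀ a ∈ A.erase l, B a p l := by
  classical
  obtain ⟨r, hr⟩ : A.Nonempty := Finset.card_pos.1 (by omega)
  have hne : (A.erase r).Nonempty := by
    rw [← Finset.card_pos, Finset.card_erase_of_mem hr]; omega
  obtain ⟨l, hl, hmax⟩ := Finset.exists_max_image (A.erase r)
    (fun l => (A.filter fun z => B r z l).card) hne
  obtain ⟨hlr, hlA⟩ := Finset.mem_erase.1 hl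
  have leaf : ∀ z ∈ A.erase l, ¬ B r l z := by
    intro z hz hB
    obtain ⟨hzl, hzA⟩ := Finset.mem_erase.1 hz
    have hzr : z ≠ r := by
      rintro rfl
      exact hlr (h.eq_of_self hB)
    have := hmax z (Finset.mem_erase.2 ⟨hzr, hzA⟩)
    refine absurd this (not_le.2 (Finset.card_lt_card ?_))
    rw [Finset.ssubset_iff_of_subset]
    · refine ⟨z, Finset.mem_filter.2 ⟨hzA, h.right _ _⟩, fun hz' => hzl ?_⟩
      exact h.antisymm (Finset.mem_filter.1 hz').2 hB
    · intro w hw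
      rw [Finset.mem_filter] at hw ⊢
      exact ⟨hw.1, h.trans hB hw.2⟩
  have leaf' : ∀ a ∈ A.erase l, ∀ b ∈ A.erase l, ¬ B a l b := by
    intro a ha b hb hB
    rcases h.split hB r with h₁ | h₁
    · exact leaf a ha (h.symm h₁)
    · exact leaf b hb h₁
  have hAl : MedianClosed B (A.erase l) := by
    intro a ha b hb c hc m hm
    refine Finset.mem_erase.2 ⟨?_, hA a (Finset.mem_of_mem_erase ha) b
      (Finset.mem_of_mem_erase hb) c (Finset.mem_of_mem_erase hc) m hm⟩
    rintro rfl
    exact leaf' a ha b hb hm.1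
  obtain ⟨p, hp, hmin⟩ := Finset.exists_min_image (A.erase l)
    (fun p => (A.filter fun z => B p z l).card)
    ⟨r, Finset.mem_erase.2 ⟨hlr.symm, hr⟩⟩
  refine ⟨l, hlA, hAl, leaf', p, hp, fun a ha => ?_⟩
  obtain ⟨m, h₁, h₂, h₃⟩ := h.median a p l
  have hml : m ≠ l := by
    rintro rfl
    exact leaf' a ha p hp h₁
  have hmA : m ∈ A := hA a (Finset.mem_of_mem_erase ha) p (Finset.mem_of_mem_erase hp) l hlA m
    ⟨h₁, h₂, h₃⟩
  by_cases hmp : m = p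
  · rwa [← hmp]
  refine absurd (hmin m (Finset.mem_erase.2 ⟨hml, hmA⟩)) (not_le.2 (Finset.card_lt_card ?_))
  rw [Finset.ssubset_iff_of_subset]
  · refine ⟨p, Finset.mem_filter.2 ⟨Finset.mem_of_mem_erase hp, h.left _ _⟩, fun hp' => hmp ?_⟩
    exact h.antisymm (h.symm h₂) (h.symm (Finset.mem_filter.1 hp').2)
  · intro w hw
    rw [Finset.mem_filter] at hw ⊢
    exact ⟨hw.1, h.symm (h.trans (h.symm h₂) (h.symm hw.2))⟩

lemma card_dirs (h : IsTreeAction G B) {A : Finset T} (hA : MedianClosed B A)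
    (hne : A.Nonempty) : (dirs h A).card + 2 = 2 * A.card := by
  classical
  induction hn : A.card generalizing A with
  | zero => simp_all
  | succ n ih =>
    rcases Nat.eq_zero_or_pos n with rfl | hpos
    · obtain ⟨a, rfl⟩ := Finset.card_eq_one.1 hn
      have : dirs h {a} = ∅ := by
        rw [Finset.eq_empty_iff_forall_notMem]
        intro d hd
        obtain ⟨y, hy, b, hb, hyb, -⟩ := mem_dirs.1 hd
        simp_all
      simp [this]
    obtain ⟨l, hl, hAl, hleaf, p, hp, hnear⟩ := exists_leaf h.toIsPretree hA (by omega)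
    have hc := Finset.card_erase_of_mem hl
    have hpl : p ≠ l := Finset.ne_of_mem_erase hp
    have hpA := Finset.mem_of_mem_erase hp
    have ih' := ih hAl ⟨p, hp⟩ (by omega)
    set d₁ := Dir.mk h ⟨(l, p), hpl.symm⟩ with hd₁
    set d₂ := Dir.mk h ⟨(p, l), hpl⟩ with hd₂
    have e₁ : d₁ ∉ dirs h (A.erase l) := fun hd => by
      have := base_mem_of_mem_dirs hd
      simp [hd₁] at this
    have e₂ : d₂ ∉ dirs h (A.erase l) := fun hd => by
      obtain ⟨y, hy, a, ha, hya, he⟩ := mem_dirs.1 hd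
      rw [hd₂, Dir.mk_eq] at he
      obtain ⟨he₁, he₂⟩ := he
      simp only at he₁ he₂
      subst he₁
      exact he₂ (hnear a ha)
    have e₃ : d₁ ≠ d₂ := fun e => hpl.symm (congrArg Dir.base e)
    have hU : dirs h A = insert d₁ (insert d₂ (dirs h (A.erase l))) := by
      ext d
      rw [Finset.mem_insert, Finset.mem_insert]
      constructor
      · intro hd
        obtain ⟨y, hy, a, ha, hya, rfl⟩ := mem_dirs.1 hd
        by_cases hyl : y = l
        · subst hyl
          left
          rw [hd₁, Dir.mk_eq]
          exact ⟨rfl, hleaf _ (Finset.mem_erase.2 ⟨hya.symm, ha⟩) _ hp⟩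
        right
        have hy' := Finset.mem_erase.2 ⟨hyl, hy⟩
        by_cases hal : a = l
        · subst hal
          by_cases hyp : y = p
          · subst hyp
            exact Or.inl rfl
          · right
            refine mem_dirs.2 ⟨y, hy', p, hp, hyp, ?_⟩
            rw [Dir.mk_eq]
            refine ⟨rfl, fun hB => hyp ?_⟩
            exact h.antisymm (h.symm hB) (h.symm (hnear y hy'))
        · exact Or.inr (mem_dirs.2 ⟨y, hy', a, Finset.mem_erase.2 ⟨hal, ha⟩, hya, rfl⟩)
      · rintro (rfl | rfl | hd)
        · exact mem_dirs.2 ⟨l, hl, p, hpA, hpl.symm, rfl⟩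
        · exact mem_dirs.2 ⟨p, hpA, l, hl, hpl, rfl⟩
        · exact dirs_mono (Finset.erase_subset _ _) hd
    rw [hU, Finset.card_insert_of_notMem (by simp [e₁, e₃]), Finset.card_insert_of_notMem e₂]
    omega

end Counting

end Directions

end GrowthRate

namespace GrowthRate

open FreeGroup

lemma letter_mul_cases {α : Type*} [DecidableEq α] (j : α) (u : FreeGroup α) :
    (u.toWord.head? = some (j, false) ∧ (of j * u).norm < u.norm) ∨
      ((of j * u).toWord.head? = some (j, true) ∧ u.norm < (of j * u).norm) := by
  have h : (of j * u).toWord = reduce ((j, true) :: u.toWord) := by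
    rw [toWord_mul, toWord_of]; rfl
  rw [reduce.cons, reduce_toWord] at h
  rcases hu : u.toWord with _ | ⟨⟨a, b⟩, l⟩
  · right
    rw [hu] at h
    simp only at h
    simp [FreeGroup.norm, h, hu]
  · rw [hu] at h
    simp only at h
    split_ifs at h with hab
    · left
      obtain ⟨rfl, hb⟩ := hab
      simp [FreeGroup.norm, h, hu]
      cases b <;> simp_all
    · right
      simp [FreeGroup.norm, h, hu]

section Graph

variable {α : Type*} [DecidableEq α]

lemma exists_equivariant {G X : Type*} [Group G] [MulAction G X]
    (hfree : ∀ (g : G) (x : X), g • x = x → g = 1) :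
    ∃ τ : X → G, ∀ g x, τ (g • x) = g * τ x := by
  have hrep : ∀ x : X, ∃ g : G, g • (Quotient.mk (MulAction.orbitRel G X) x).out = x := by
    intro x
    have := Quotient.mk_out (s := MulAction.orbitRel G X) x
    obtain ⟨g, hg⟩ := this
    exact ⟨g⁻¹, by rw [← hg]; simp⟩
  choose τ hτ using hrep
  refine ⟨τ, fun g x => ?_⟩
  have hq : Quotient.mk (MulAction.orbitRel G X) (g • x) =
      Quotient.mk (MulAction.orbitRel G X) x := Quotient.sound ⟨g, rfl⟩
  have h₁ := hτ (g • x)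
  rw [hq] at h₁
  have h₂ : (τ (g • x))⁻¹ * (g * τ x) = 1 := by
    refine hfree _ (Quotient.mk (MulAction.orbitRel G X) x).out ?_
    rw [mul_smul, mul_smul, hτ x, inv_smul_eq_iff, h₁]
  exact (inv_mul_eq_one.1 h₂)

/-- A finite set in a free action of a free group spans a forest. -/
lemma card_edges_lt_of_free {X : Type*} [MulAction (FreeGroup α) X]
    (hfree : ∀ (g : FreeGroup α) (x : X), g • x = x → g = 1) {D : Finset X} (hD : D.Nonempty)
    {E : Finset (α × X)} (hE : ∀ e ∈ E, e.2 ∈ D ∧ of e.1 • e.2 ∈ D) : E.card + 1 ≤ D.card := by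
  classical
  obtain ⟨τ, hτ⟩ := exists_equivariant hfree
  obtain ⟨d₀, hd₀, hmin⟩ := Finset.exists_min_image D (fun d => (τ d).norm) hD
  let far : α × X → X := fun e =>
    if (τ e.2).toWord.head? = some (e.1, false) then e.2 else of e.1 • e.2
  have hfar : ∀ e : α × X, ((τ (far e)).toWord.head? = some (e.1, false) ∧ e.2 = far e ∧
      (τ (of e.1 • e.2)).norm < (τ (far e)).norm) ∨
      ((τ (far e)).toWord.head? = some (e.1, true) ∧ of e.1 • e.2 = far e ∧
      (τ e.2).norm < (τ (far e)).norm) := by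
    intro e
    by_cases h : (τ e.2).toWord.head? = some (e.1, false)
    · left
      simp only [far, h, if_true, true_and]
      rw [hτ]
      rcases letter_mul_cases e.1 (τ e.2) with h' | h'
      · exact h'.2
      · exfalso
        have := h'.2
        rw [FreeGroup.norm, FreeGroup.norm, toWord_mul, toWord_of] at this
        have hl : ∃ l, (τ e.2).toWord = (e.1, false) :: l := by
          rcases hw : (τ e.2).toWord with _ | ⟨a, l⟩
          · simp [hw] at h
          · simp [hw] at h; exact ⟨l, by rw [h]⟩
        obtain ⟨l, hl⟩ := hl
        have hred : Red ((e.1, true) :: (e.1, false) :: l) l :=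
          Relation.ReflTransGen.single (by
            simpa using Red.Step.cons_not (x := e.1) (b := true) (L := l))
        rw [hl] at this
        have h₂ : reduce ([(e.1, true)] ++ (e.1, false) :: l) = reduce l :=
          reduce.eq_of_red hred
        rw [h₂] at this
        have h₃ := norm_mk_le (L₁ := l)
        rw [FreeGroup.norm, toWord_mk] at h₃
        simp at this
        omega
    · right
      simp only [far, h, if_false, true_and]
      rw [hτ]
      rcases letter_mul_cases e.1 (τ e.2) with h' | h'
      · exact absurd h'.1 h
      · exact h'
  have hinj : Set.InjOn far E := by
    intro e _ e' _ hee
    rcases hfar e with ⟨h₁, h₂, -⟩ | ⟨h₁, h₂, -⟩ <;>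
    rcases hfar e' with ⟨k₁, k₂, -⟩ | ⟨k₁, k₂, -⟩ <;>
    rw [hee, k₁] at h₁ <;> simp at h₁
    · exact Prod.ext h₁.symm (by rw [h₂, k₂, hee])
    · refine Prod.ext h₁.symm (MulAction.injective (of e.1) ?_)
      simp only
      rw [h₂, ← h₁, k₂, hee]
  have hmaps : ∀ e ∈ E, far e ∈ D.erase d₀ := by
    intro e he
    obtain ⟨h₁, h₂⟩ := hE e he
    rcases hfar e with ⟨-, h, hlt⟩ | ⟨-, h, hlt⟩
    · refine Finset.mem_erase.2 ⟨fun h' => ?_, h ▸ h₁⟩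
      have := hmin _ h₂
      rw [h'] at hlt
      omega
    · refine Finset.mem_erase.2 ⟨fun h' => ?_, h ▸ h₂⟩
      have := hmin _ h₁
      rw [h'] at hlt
      omega
  have := Finset.card_le_card_of_injOn far hmaps hinj
  rw [Finset.card_erase_of_mem hd₀] at this
  have := Finset.card_pos.2 hD
  omega

variable {T : Type*} [MulAction (FreeGroup α) T]

/-- Connectedness of the graph induced on a set of points by the edges `y — x_j y`. -/
def EdgeConnected (C : Finset T) : Prop :=
  ∀ P : T → Prop, (∀ (j : α), ∀ y ∈ C, (of j : FreeGroup α) • y ∈ C →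
    (P y ↔ P ((of j : FreeGroup α) • y))) → ∀ y ∈ C, ∀ z ∈ C, P y → P z

/-- A connected graph has a spanning tree, and each edge of the tree is charged to a vertex
other than the root. -/
lemma exists_spanning_tree {C : Finset T} (hC : EdgeConnected (α := α) C) {r : T} (hr : r ∈ C)
    {E : Finset (α × T)} (hE : ∀ e, e ∈ E ↔ e.2 ∈ C ∧ (of e.1 : FreeGroup α) • e.2 ∈ C)
    (w : T → ℕ) (u : α × T → ℕ) (hu : ∀ e ∈ E, u e ≤ w e.2)
    (hu' : ∀ e ∈ E, u e ≤ w ((of e.1 : FreeGroup α) • e.2)) :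
    ∃ E' ⊆ E, E'.card + 1 = C.card ∧ ∑ e ∈ E', u e + w r ≤ ∑ y ∈ C, w y := by
  classical
  have key : ∀ k, k + 1 ≤ C.card → ∃ S ⊆ C, r ∈ S ∧ S.card = k + 1 ∧ ∃ E' ⊆ E,
      (∀ e ∈ E', e.2 ∈ S ∧ (of e.1 : FreeGroup α) • e.2 ∈ S) ∧ E'.card = k ∧
      ∑ e ∈ E', u e + w r ≤ ∑ y ∈ S, w y := by
    intro k
    induction k with
    | zero =>
      intro _
      exact ⟨{r}, by simpa using hr, by simp, by simp, ∅, by simp, by simp, by simp, by simp⟩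
    | succ k ih =>
      intro hk
      obtain ⟨S, hSC, hrS, hSk, E', hE'E, hE'S, hE'k, hsum⟩ := ih (by omega)
      obtain ⟨z, hz, hzS⟩ : ∃ z ∈ C, z ∉ S := by
        by_contra! hcon
        have := Finset.card_le_card (show C ⊆ S from hcon)
        omega
      have hex : ∃ e ∈ E, ∃ v, v ∉ S ∧ v ∈ C ∧ u e ≤ w v ∧ e ∉ E' ∧
          e.2 ∈ insert v S ∧ (of e.1 : FreeGroup α) • e.2 ∈ insert v S := by
        by_contra! hcon
        refine hzS (hC (· ∈ S) (fun j y hy hjy => ?_) r hr z hz hrS)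
        have he : (j, y) ∈ E := (hE _).2 ⟨hy, hjy⟩
        constructor
        · intro h₁
          by_contra h₂
          exact hcon (j, y) he _ h₂ hjy (hu' _ he) (fun h => h₂ (hE'S _ h).2)
            (Finset.mem_insert_of_mem h₁) (Finset.mem_insert_self _ _)
        · intro h₁
          by_contra h₂
          exact hcon (j, y) he _ h₂ hy (hu _ he) (fun h => h₂ (hE'S _ h).1)
            (Finset.mem_insert_self _ _) (Finset.mem_insert_of_mem h₁)
      obtain ⟨e, he, v, hvS, hvC, huv, heE', h₁, h₂⟩ := hex
      refine ⟨insert v S, Finset.insert_subset hvC hSC, Finset.mem_insert_of_mem hrS,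
        by rw [Finset.card_insert_of_notMem hvS, hSk], insert e E',
        Finset.insert_subset he hE'E, ?_, by rw [Finset.card_insert_of_notMem heE', hE'k], ?_⟩
      · intro e' he'
        rcases Finset.mem_insert.1 he' with rfl | he'
        · exact ⟨h₁, h₂⟩
        · exact ⟨Finset.mem_insert_of_mem (hE'S _ he').1,
            Finset.mem_insert_of_mem (hE'S _ he').2⟩
      · rw [Finset.sum_insert heE', Finset.sum_insert hvS]
        omega
  have hpos := Finset.card_pos.2 ⟨r, hr⟩
  obtain ⟨S, hSC, -, hSk, E', hE'E, -, hE'k, hsum⟩ := key (C.card - 1) (by omega)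
  have hS : S = C := Finset.eq_of_subset_of_card_le hSC (by omega)
  subst hS
  exact ⟨E', hE'E, by omega, hsum⟩

/-- Independent elements of a vertex stabilizer give independent cycles. -/
lemma card_add_le_of_stabilizer {C : Finset T} (hC : EdgeConnected (α := α) C) {c : T}
    (hc : c ∈ C) {E : Finset (α × T)}
    (hE : ∀ e, e ∈ E ↔ e.2 ∈ C ∧ (of e.1 : FreeGroup α) • e.2 ∈ C)
    {r : ℕ} {χ : Fin r → FreeGroup α → ℚ}
    (hχ : ∀ l g h, g • c = c → h • c = c → χ l (g * h) = χ l g + χ l h)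
    {g : Fin r → FreeGroup α} (hg : ∀ l, g l • c = c)
    (hdual : ∀ l l', χ l (g l') = if l = l' then 1 else 0)
    (hpath : ∀ l, ∀ s, s <:+ (g l).toWord → FreeGroup.mk s • c ∈ C) :
    C.card + r ≤ E.card + 1 := by
  classical
  obtain ⟨τ, hτ₁, hτ⟩ : ∃ τ : T → FreeGroup α, τ c = 1 ∧
      ∀ y, (∃ h : FreeGroup α, h • c = y) → τ y • c = y := by
    have : ∀ y, ∃ t : FreeGroup α, (y = c → t = 1) ∧
        ((∃ h : FreeGroup α, h • c = y) → t • c = y) := by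
      intro y
      by_cases hy : y = c
      · exact ⟨1, fun _ => rfl, fun _ => by simp [hy]⟩
      · by_cases h : ∃ h : FreeGroup α, h • c = y
        · obtain ⟨t, ht⟩ := h
          exact ⟨t, fun h => absurd h hy, fun _ => ht⟩
        · exact ⟨1, fun h => absurd h hy, fun h' => absurd h' h⟩
    choose τ h₁ h₂ using this
    exact ⟨τ, h₁ c rfl, h₂⟩
  let φ : Fin r → α × T → ℚ := fun l e => χ l ((τ ((of e.1 : FreeGroup α) • e.2))⁻¹ *
    of e.1 * τ e.2)
  have hE₁ : ∀ e : E, e.1.2 ∈ C := fun e => ((hE _).1 e.2).1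
  have hE₂ : ∀ e : E, (of e.1.1 : FreeGroup α) • e.1.2 ∈ C := fun e => ((hE _).1 e.2).2
  let Λ : ((C → ℚ) × (Fin r → ℚ)) →ₗ[ℚ] ((E → ℚ) × ℚ) :=
    { toFun := fun p => (fun e => p.1 ⟨_, hE₂ e⟩ - p.1 ⟨_, hE₁ e⟩ + ∑ l, p.2 l * φ l e.1,
        p.1 ⟨c, hc⟩)
      map_add' := fun p q => by
        ext e
        · simp only [Prod.fst_add, Prod.snd_add, Pi.add_apply, add_mul, Finset.sum_add_distrib]
          ring
        · simp
      map_smul' := fun a p => by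
        ext e
        · simp only [Prod.smul_fst, Prod.smul_snd, Pi.smul_apply, smul_eq_mul, RingHom.id_apply,
            mul_assoc, ← Finset.mul_sum]
          ring
        · simp }
  have hinj : Function.Injective Λ := by
    rw [← LinearMap.ker_eq_bot, LinearMap.ker_eq_bot']
    rintro ⟨f, a⟩ hfa
    obtain ⟨f', hf'⟩ : ∃ f' : T → ℚ, ∀ y (hy : y ∈ C), f' y = f ⟨y, hy⟩ :=
      ⟨fun y => if hy : y ∈ C then f ⟨y, hy⟩ else 0, fun y hy => by simp [hy]⟩
    have hedge : ∀ j y, y ∈ C → (of j : FreeGroup α) • y ∈ C →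
        f' ((of j : FreeGroup α) • y) = f' y - ∑ l, a l * φ l (j, y) := by
      intro j y hy hjy
      have := congrFun (congrArg Prod.fst hfa) ⟨(j, y), (hE _).2 ⟨hy, hjy⟩⟩
      simp only [Λ, LinearMap.coe_mk, AddHom.coe_mk, Prod.fst_zero, Pi.zero_apply] at this
      rw [hf' _ hy, hf' _ hjy]
      linarith
    have hroot : f' c = 0 := by
      rw [hf' _ hc]
      exact congrArg Prod.snd hfa
    have one : ∀ l, χ l 1 = 0 := fun l => by
      have := hχ l 1 1 (by simp) (by simp)
      simp at this
      exact this
    have tele : ∀ s : List (α × Bool), (∀ t, t <:+ s → FreeGroup.mk t • c ∈ C) →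
        f' (FreeGroup.mk s • c) =
          - ∑ l, a l * χ l ((τ (FreeGroup.mk s • c))⁻¹ * FreeGroup.mk s) := by
      intro s
      induction s with
      | nil =>
        intro _
        simp [← FreeGroup.one_eq_mk, hτ₁, one, hroot]
      | cons x s ih =>
        intro hs
        have ih' := ih fun t ht => hs t (ht.trans (List.suffix_cons x s))
        have hy : FreeGroup.mk s • c ∈ C := hs s (List.suffix_cons x s)
        have hz : FreeGroup.mk (x :: s) • c ∈ C := hs _ List.suffix_rfl
        set h := FreeGroup.mk s with hh
        set y := h • c with hy'
        have hτy : τ y • c = y := hτ y ⟨h, rfl⟩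
        obtain ⟨j, b⟩ := x
        cases b with
        | true =>
          have hm : FreeGroup.mk ((j, true) :: s) = of j * h := by
            rw [of, hh, mul_mk]; rfl
          rw [hm, mul_smul] at hz ⊢
          have hτz := hτ (of j • y) ⟨of j * h, by rw [mul_smul]⟩
          rw [hedge j y hy hz, ih', ← Finset.sum_neg_distrib, ← Finset.sum_sub_distrib,
            ← Finset.sum_neg_distrib]
          refine Finset.sum_congr rfl fun l _ => ?_
          have := hχ l ((τ (of j • y))⁻¹ * of j * τ y) ((τ y)⁻¹ * h)
            (by rw [mul_smul, mul_smul, hτy, inv_smul_eq_iff, hτz])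
            (by rw [mul_smul, inv_smul_eq_iff, hτy])
          rw [show (τ (of j • y))⁻¹ * of j * τ y * ((τ y)⁻¹ * h) =
            (τ (of j • y))⁻¹ * (of j * h) by group] at this
          rw [this]
          simp only [φ]
          ring
        | false =>
          have hm : FreeGroup.mk ((j, false) :: s) = (of j)⁻¹ * h := by
            rw [of, hh, inv_mk, mul_mk]; rfl
          rw [hm, mul_smul] at hz ⊢
          set z := (of j : FreeGroup α)⁻¹ • y with hzdef
          have hzy : (of j : FreeGroup α) • z = y := by rw [hzdef, smul_inv_smul]
          have hτz := hτ z ⟨(of j)⁻¹ * h, by rw [mul_smul]⟩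
          have he := hedge j z hz (by rw [hzy]; exact hy)
          rw [hzy, ih'] at he
          have he' : f' z = - ∑ l, a l * χ l ((τ y)⁻¹ * h) + ∑ l, a l * φ l (j, z) := by
            linarith
          rw [he', ← Finset.sum_neg_distrib, ← Finset.sum_add_distrib, ← Finset.sum_neg_distrib]
          refine Finset.sum_congr rfl fun l _ => ?_
          have := hχ l ((τ y)⁻¹ * of j * τ z) ((τ z)⁻¹ * ((of j)⁻¹ * h))
            (by rw [mul_smul, mul_smul, hτz, inv_smul_eq_iff, hτy, hzy])
            (by rw [mul_smul, mul_smul, inv_smul_eq_iff, hτz])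
          rw [show (τ y)⁻¹ * of j * τ z * ((τ z)⁻¹ * ((of j)⁻¹ * h)) = (τ y)⁻¹ * h by group]
            at this
          rw [this]
          simp only [φ, hzy]
          ring
    have ha : a = 0 := by
      funext l
      have := tele (g l).toWord (hpath l)
      rw [mk_toWord, hg, hroot, hτ₁, inv_one, one_mul] at this
      simp_rw [hdual] at this
      simpa using this
    have hf : f = 0 := by
      funext ⟨y, hy⟩
      rw [← hf' y hy]
      refine hC (fun y => f' y = 0) (fun j y hy hjy => ?_) c hc y hy hroot
      rw [hedge j y hy hjy, ha]
      simp
    rw [ha, hf]; rfl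
  have := LinearMap.finrank_le_finrank_of_injective hinj
  simpa using this

end Graph

end GrowthRate

namespace GrowthRate

open FreeGroup

section Index

variable {α : Type*} {T : Type*} [MulAction (FreeGroup α) T]
  [DecidableEq T] {B : T → T → T → Prop}

/-- The points of `V` mapped into `V` by the generator `j`. -/
def domain (V : Finset T) (j : α) : Finset T := V.filter fun y => (of j : FreeGroup α) • y ∈ V

lemma mem_domain {V : Finset T} {j : α} {y : T} :
    y ∈ domain V j ↔ y ∈ V ∧ (of j : FreeGroup α) • y ∈ V := by
  simp [domain]

lemma medianClosed_domain (h : IsTreeAction (FreeGroup α) B) {V : Finset T}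
    (hV : MedianClosed B V) (j : α) : MedianClosed B (domain V j) := by
  intro a ha b hb c hc m hm
  rw [mem_domain] at *
  exact ⟨hV a ha.1 b hb.1 c hc.1 m hm, hV _ ha.2 _ hb.2 _ hc.2 _
    ⟨h.smul _ hm.1, h.smul _ hm.2.1, h.smul _ hm.2.2⟩⟩

variable [DecidableEq α]

lemma card_component_dirs (h : IsTreeAction (FreeGroup α) B) {V C : Finset T}
    (hV : 2 ≤ V.card) (hCV : C ⊆ V) (hC : C.Nonempty)
    (hclosed : ∀ (j : α), ∀ y ∈ V, (of j : FreeGroup α) • y ∈ V → y ∈ C →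
      (of j : FreeGroup α) • y ∈ C)
    {DE : Finset (α × Dir h)}
    (hDE : ∀ p, p ∈ DE ↔ p.2 ∈ dirs h (domain V p.1) ∧ p.2.base ∈ C) :
    DE.card + 1 ≤ ((dirs h V).filter fun d => d.base ∈ C).card := by
  refine card_edges_lt_of_free (fun g d => Dir.eq_one_of_smul_eq g d) ?_ fun e he => ?_
  · obtain ⟨y, hy⟩ := hC
    obtain ⟨a, ha, hay⟩ := Finset.exists_mem_ne (by omega : 1 < V.card) y
    exact ⟨Dir.mk h ⟨(y, a), hay.symm⟩, Finset.mem_filter.2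
      ⟨mem_dirs.2 ⟨y, hCV hy, a, ha, hay.symm, rfl⟩, hy⟩⟩
  · obtain ⟨h₁, h₂⟩ := (hDE e).1 he
    have hb := mem_domain.1 (base_mem_of_mem_dirs h₁)
    refine ⟨Finset.mem_filter.2 ⟨dirs_mono (Finset.filter_subset _ _) h₁, h₂⟩,
      Finset.mem_filter.2 ⟨smul_mem_dirs _ (fun a ha => (mem_domain.1 ha).2) h₁, ?_⟩⟩
    rw [Dir.base_smul]
    exact hclosed _ _ hb.1 hb.2 h₂

lemma two_mul_card_component_le (h : IsTreeAction (FreeGroup α) B) {V C : Finset T}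
    (hV : 2 ≤ V.card) (hCV : C ⊆ V) (hC : C.Nonempty)
    (hclosed : ∀ (j : α), ∀ y ∈ V, (of j : FreeGroup α) • y ∈ V → y ∈ C →
      (of j : FreeGroup α) • y ∈ C) (hconn : EdgeConnected (α := α) C)
    {E : Finset (α × T)} (hE : ∀ e, e ∈ E ↔ e.2 ∈ C ∧ (of e.1 : FreeGroup α) • e.2 ∈ C)
    {DE : Finset (α × Dir h)}
    (hDE : ∀ p, p ∈ DE ↔ p.2 ∈ dirs h (domain V p.1) ∧ p.2.base ∈ C)
    (hbr : ∀ y ∈ C, ∃ a ∈ V, ∃ b ∈ V, a ≠ y ∧ b ≠ y ∧ B a y b) :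
    2 * C.card + DE.card ≤ 2 * E.card + ((dirs h V).filter fun d => d.base ∈ C).card := by
  classical
  have hfree := card_component_dirs h hV hCV hC hclosed hDE
  obtain ⟨r, hr⟩ := hC
  obtain ⟨E', hE'E, hcard, hsum⟩ := exists_spanning_tree hconn hr hE
    (fun y => ((dirs h V).filter fun d => d.base = y).card)
    (fun e => ((dirs h (domain V e.1)).filter fun d => d.base = e.2).card)
    (fun e _ => Finset.card_le_card (Finset.filter_subset_filter _
      (dirs_mono (Finset.filter_subset _ _))))
    (fun e _ => by
      refine Finset.card_le_card_of_injOn (fun d => (of e.1 : FreeGroup α) • d) ?_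
        (MulAction.injective _).injOn
      intro d hd
      obtain ⟨h₁, h₂⟩ := Finset.mem_filter.1 hd
      refine Finset.mem_filter.2
        ⟨smul_mem_dirs _ (fun a ha => (mem_domain.1 ha).2) h₁, ?_⟩
      rw [Dir.base_smul, h₂])
  have hle := Finset.card_le_card hE'E
  by_cases heq : E'.card = E.card
  · have hEE : E' = E := Finset.eq_of_subset_of_card_le hE'E heq.ge
    subst hEE
    have h₁ : ∑ y ∈ C, ((dirs h V).filter fun d => d.base = y).card =
        ((dirs h V).filter fun d => d.base ∈ C).card := by
      rw [Finset.card_eq_sum_card_fiberwise (s := (dirs h V).filter fun d => d.base ∈ C)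
        (f := Dir.base) (t := C) (fun d hd => (Finset.mem_filter.1 hd).2)]
      refine Finset.sum_congr rfl fun y hy => ?_
      rw [Finset.filter_filter]
      refine congrArg _ (Finset.filter_congr fun d _ => ?_)
      exact ⟨fun e => ⟨e ▸ hy, e⟩, fun e => e.2⟩
    have h₂ : ∑ e ∈ E', ((dirs h (domain V e.1)).filter fun d => d.base = e.2).card =
        DE.card := by
      rw [Finset.card_eq_sum_card_fiberwise (f := fun p : α × Dir h => (p.1, p.2.base)) (t := E')]
      · refine Finset.sum_congr rfl fun e he => ?_
        refine Finset.card_bij (fun d _ => (e.1, d)) ?_ ?_ ?_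
        · intro d hd
          obtain ⟨k₁, k₂⟩ := Finset.mem_filter.1 hd
          refine Finset.mem_filter.2 ⟨(hDE _).2 ⟨k₁, ?_⟩, ?_⟩
          · simp only [k₂]; exact ((hE e).1 he).1
          · simp [k₂]
        · intro d _ d' _ hdd
          exact (Prod.ext_iff.1 hdd).2
        · rintro ⟨j, d⟩ hd
          obtain ⟨k₁, rfl⟩ := Finset.mem_filter.1 hd
          exact ⟨d, Finset.mem_filter.2 ⟨((hDE _).1 k₁).1, rfl⟩, rfl⟩
      · intro p hp
        obtain ⟨k₁, k₂⟩ := (hDE p).1 hp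
        have hb := mem_domain.1 (base_mem_of_mem_dirs k₁)
        exact (hE _).2 ⟨k₂, hclosed _ _ hb.1 hb.2 k₂⟩
    have h₃ : 2 ≤ ((dirs h V).filter fun d => d.base = r).card := by
      obtain ⟨a, ha, b, hb, har, hbr, hab⟩ := hbr r hr
      refine Finset.one_lt_card.2 ⟨Dir.mk h ⟨(r, a), har.symm⟩, Finset.mem_filter.2
        ⟨mem_dirs.2 ⟨r, hCV hr, a, ha, har.symm, rfl⟩, rfl⟩, Dir.mk h ⟨(r, b), hbr.symm⟩,
        Finset.mem_filter.2 ⟨mem_dirs.2 ⟨r, hCV hr, b, hb, hbr.symm, rfl⟩, rfl⟩, fun e => ?_⟩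
      exact (Dir.mk_eq.1 e).2 hab
    rw [h₁, h₂] at hsum
    omega
  · omega

/-- The index inequality for free group actions on trees with trivial arc stabilizers. -/
theorem index_bound [Fintype α] (h : IsTreeAction (FreeGroup α) B)
    (hfix : ∀ y : T, ∃ j, (of j : FreeGroup α) • y ≠ y)
    {ι : Type*} [Fintype ι] [Nonempty ι] {c : ι → T}
    (hc : ∀ i i' (g : FreeGroup α), g • c i = c i' → i = i') {r : ℕ}
    {χ : ι → Fin r → FreeGroup α → ℚ}
    (hχ : ∀ i l g h, g • c i = c i → h • c i = c i → χ i l (g * h) = χ i l g + χ i l h)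
    {g : ι → Fin r → FreeGroup α} (hg : ∀ i l, g i l • c i = c i)
    (hdual : ∀ i l l', χ i l (g i l') = if l = l' then 1 else 0) :
    (Fintype.card ι : ℤ) * (2 * r - 1) ≤ 2 * Fintype.card α - 2 := by
  classical
  let W : Finset T := Finset.univ.image c ∪ Finset.univ.biUnion fun i : ι =>
    Finset.univ.biUnion fun l : Fin r =>
      ((g i l).toWord.tails.map fun s => FreeGroup.mk s • c i).toFinset
  have hcW : ∀ i, c i ∈ W := fun i => Finset.mem_union_left _ (by simp)
  have hsW : ∀ i l s, s <:+ (g i l).toWord → FreeGroup.mk s • c i ∈ W := by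
    intro i l s hs
    refine Finset.mem_union_right _ ?_
    simp only [Finset.mem_biUnion, Finset.mem_univ, true_and, List.mem_toFinset, List.mem_map,
      List.mem_tails]
    exact ⟨i, l, s, hs, rfl⟩
  obtain ⟨V, hWV, hVm, hbr⟩ := h.exists_medianClosed W ⟨_, hcW (Classical.arbitrary ι)⟩
  have hVne : V.Nonempty := ⟨_, hWV (hcW (Classical.arbitrary ι))⟩
  let E : Finset (α × T) := (Finset.univ ×ˢ V).filter fun e => (of e.1 : FreeGroup α) • e.2 ∈ V
  have hE : ∀ e, e ∈ E ↔ e.2 ∈ V ∧ (of e.1 : FreeGroup α) • e.2 ∈ V := by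
    intro e; simp [E]
  by_cases hV1 : V.card < 2
  · have : V.card = 1 := by have := Finset.card_pos.2 hVne; omega
    obtain ⟨v, rfl⟩ := Finset.card_eq_one.1 this
    have hcv : ∀ i, c i = v := fun i => Finset.mem_singleton.1 (hWV (hcW i))
    have hι : Fintype.card ι = 1 := by
      rw [Fintype.card_eq_one_iff]
      exact ⟨Classical.arbitrary ι, fun i => hc _ _ 1 (by rw [one_smul, hcv, hcv])⟩
    let i := Classical.arbitrary ι
    have hle := card_add_le_of_stabilizer (α := α) (C := {v}) (c := c i) (E := E) (r := r)
      (χ := χ i) (g := g i) (by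
        intro P _ y hy z hz hP
        rw [Finset.mem_singleton] at hy hz
        rwa [hz, ← hy]) (by simp [hcv]) hE (hχ i) (hg i) (hdual i)
        (fun l s hs => hWV (hsW i l s hs))
    obtain ⟨j, hj⟩ := hfix v
    have hlt : E.card < Fintype.card α := by
      have : E.card ≤ ((Finset.univ : Finset α).erase j).card := by
        refine Finset.card_le_card_of_injOn Prod.fst ?_ ?_
        · intro e he
          obtain ⟨h₁, h₂⟩ := (hE e).1 he
          rw [Finset.mem_singleton] at h₁ h₂
          rw [h₁] at h₂
          refine Finset.mem_coe.2 (Finset.mem_erase.2 ⟨?_, Finset.mem_univ _⟩)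
          intro hh
          exact hj (hh ▸ h₂)
        · intro e he e' he' hh
          have h₁ := Finset.mem_singleton.1 ((hE e).1 he).1
          have h₂ := Finset.mem_singleton.1 ((hE e').1 he').1
          exact Prod.ext hh (h₁.trans h₂.symm)
      have h2 := Finset.card_erase_lt_of_mem (Finset.mem_univ j)
      rw [Finset.card_univ] at h2
      omega
    rw [Finset.card_singleton] at hle
    rw [hι]
    push_cast
    omega
  have hV2 : 2 ≤ V.card := by omega
  let R : T → T → Prop := fun y z => y ∈ V ∧ z ∈ V ∧ ∃ j : α, z = (of j : FreeGroup α) • y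
  let q : T → Quotient (Relation.EqvGen.setoid R) := Quotient.mk _
  have hqR : ∀ {y z}, R y z → q y = q z := fun hyz => Quotient.sound (Relation.EqvGen.rel _ _ hyz)
  have horb' : ∀ y z, Relation.EqvGen R y z → ∃ k : FreeGroup α, k • y = z := by
    intro y z hyz
    induction hyz with
    | rel y z hyz => obtain ⟨-, -, j, rfl⟩ := hyz; exact ⟨_, rfl⟩
    | refl y => exact ⟨1, one_smul _ _⟩
    | symm y z h₁ ih =>
      obtain ⟨k, rfl⟩ := ih
      exact ⟨k⁻¹, by simp⟩
    | trans y z w h₁ h₂ ih₁ ih₂ =>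
      obtain ⟨k, rfl⟩ := ih₁
      obtain ⟨k', rfl⟩ := ih₂
      exact ⟨k' * k, by rw [mul_smul]⟩
  have horb : ∀ {y z}, q y = q z → ∃ k : FreeGroup α, k • y = z :=
    fun hyz => horb' _ _ (Quotient.exact hyz)
  let C : Quotient (Relation.EqvGen.setoid R) → Finset T := fun k => V.filter fun y => q y = k
  let DE : Finset (α × Dir h) :=
    (Finset.univ ×ˢ dirs h V).filter fun p => p.2 ∈ dirs h (domain V p.1)
  let Q := V.image q
  have hclosed : ∀ k (j : α), ∀ y ∈ V, (of j : FreeGroup α) • y ∈ V →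
      (y ∈ C k ↔ (of j : FreeGroup α) • y ∈ C k) := by
    intro k j y hy hjy
    simp only [C, Finset.mem_filter, hy, hjy, true_and]
    rw [hqR ⟨hy, hjy, j, rfl⟩]
  have hconn : ∀ k, EdgeConnected (α := α) (C k) := by
    intro k P hP y hy z hz hPy
    obtain ⟨hyV, hyk⟩ := Finset.mem_filter.1 hy
    obtain ⟨hzV, hzk⟩ := Finset.mem_filter.1 hz
    have hyz : Relation.EqvGen R y z := Quotient.exact (hyk.trans hzk.symm)
    have : ∀ y z, Relation.EqvGen R y z → q y = k → (P y ↔ P z) := by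
      intro y z hyz
      induction hyz with
      | rel y z hyz =>
        intro hk
        obtain ⟨h₁, h₂, j, rfl⟩ := id hyz
        exact hP j y (Finset.mem_filter.2 ⟨h₁, hk⟩)
          (Finset.mem_filter.2 ⟨h₂, (hqR hyz).symm.trans hk⟩)
      | refl y => exact fun _ => Iff.rfl
      | symm y z h₁ ih => exact fun hk => (ih ((Quotient.sound h₁ : q y = q z).trans hk)).symm
      | trans y z w h₁ h₂ ih₁ ih₂ =>
        exact fun hk => (ih₁ hk).trans (ih₂ ((Quotient.sound h₁ : q y = q z).symm.trans hk))
    exact (this y z hyz hyk).1 hPy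
  have hEk : ∀ k e, e ∈ E.filter (fun e => q e.2 = k) ↔
      e.2 ∈ C k ∧ (of e.1 : FreeGroup α) • e.2 ∈ C k := by
    intro k e
    constructor
    · intro he
      obtain ⟨he, hk⟩ := Finset.mem_filter.1 he
      have h₁ := (hE e).1 he
      have h₂ : e.2 ∈ C k := Finset.mem_filter.2 ⟨h₁.1, hk⟩
      exact ⟨h₂, (hclosed k _ _ h₁.1 h₁.2).1 h₂⟩
    · rintro ⟨h₁, h₂⟩
      obtain ⟨h₁, hk⟩ := Finset.mem_filter.1 h₁
      exact Finset.mem_filter.2 ⟨(hE e).2 ⟨h₁, (Finset.mem_filter.1 h₂).1⟩, hk⟩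
  have hDEk : ∀ k p, p ∈ DE.filter (fun p => q p.2.base = k) ↔
      p.2 ∈ dirs h (domain V p.1) ∧ p.2.base ∈ C k := by
    intro k p
    simp only [DE, C, Finset.mem_filter, Finset.mem_product, Finset.mem_univ, true_and]
    constructor
    · rintro ⟨⟨h₁, h₂⟩, h₃⟩
      exact ⟨h₂, base_mem_of_mem_dirs h₁, h₃⟩
    · rintro ⟨h₁, h₂, h₃⟩
      exact ⟨⟨dirs_mono (Finset.filter_subset _ _) h₁, h₁⟩, h₃⟩
  have hDVk : ∀ k, (dirs h V).filter (fun d => q d.base = k) =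
      (dirs h V).filter fun d => d.base ∈ C k := by
    intro k
    refine Finset.filter_congr fun d hd => ?_
    simp [C, base_mem_of_mem_dirs hd]
  have hqs : ∀ i l s, s <:+ (g i l).toWord → q (FreeGroup.mk s • c i) = q (c i) := by
    intro i l s
    induction s with
    | nil => simp [← FreeGroup.one_eq_mk]
    | cons x s ih =>
      intro hs
      have hs' := (List.suffix_cons x s).trans hs
      have k₂ := hWV (hsW i l _ hs)
      have k₃ := hWV (hsW i l _ hs')
      rw [← ih hs']
      obtain ⟨j, b⟩ := x
      cases b with
      | true =>
        have hm : FreeGroup.mk ((j, true) :: s) = of j * FreeGroup.mk s := by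
          rw [of, mul_mk]; rfl
        rw [hm, mul_smul] at k₂ ⊢
        exact (hqR ⟨k₃, k₂, j, rfl⟩).symm
      | false =>
        have hm : FreeGroup.mk ((j, false) :: s) = (of j)⁻¹ * FreeGroup.mk s := by
          rw [of, inv_mk, mul_mk]; rfl
        rw [hm, mul_smul] at k₂ ⊢
        exact hqR ⟨k₂, k₃, j, by rw [smul_inv_smul]⟩
  have hmain : ∀ k ∈ Q, ((Finset.univ.filter fun i => q (c i) = k).card : ℤ) * (2 * r - 1) ≤
      2 * (E.filter fun e => q e.2 = k).card - 2 * (C k).card +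
        ((dirs h V).filter fun d => q d.base = k).card -
        (DE.filter fun p => q p.2.base = k).card := by
    intro k hk
    obtain ⟨y, hy, hyk⟩ := Finset.mem_image.1 hk
    have hCne : (C k).Nonempty := ⟨y, Finset.mem_filter.2 ⟨hy, hyk⟩⟩
    have hCV : C k ⊆ V := Finset.filter_subset _ _
    have hcl := fun j y hy hjy => (hclosed k j y hy hjy).1
    rw [hDVk]
    by_cases hi : ∃ i, q (c i) = k
    · obtain ⟨i, hi⟩ := hi
      have hone : (Finset.univ.filter fun i => q (c i) = k) = {i} := by
        ext i'
        simp only [Finset.mem_filter, Finset.mem_univ, true_and, Finset.mem_singleton]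
        constructor
        · intro hi'
          obtain ⟨u, hu⟩ := horb (hi'.trans hi.symm)
          exact hc _ _ u hu
        · rintro rfl; exact hi
      have h₁ := card_component_dirs h hV2 hCV hCne hcl (hDEk k)
      have hpath : ∀ l, ∀ s, s <:+ (g i l).toWord → FreeGroup.mk s • c i ∈ C k :=
        fun l s hs => Finset.mem_filter.2 ⟨hWV (hsW i l s hs), (hqs i l s hs).trans hi⟩
      have h₂ := card_add_le_of_stabilizer (hconn k)
        (Finset.mem_filter.2 ⟨hWV (hcW i), hi⟩) (hEk k) (hχ i) (hg i) (hdual i) hpath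
      rw [hone, Finset.card_singleton]
      push_cast
      omega
    · have h₁ := two_mul_card_component_le h hV2 hCV hCne hcl (hconn k) (hEk k) (hDEk k) (by
        intro y hy
        obtain ⟨hyV, hyk⟩ := Finset.mem_filter.1 hy
        refine hbr y hyV fun hyW => hi ?_
        rcases Finset.mem_union.1 hyW with hyc | hyc
        · obtain ⟨i, -, rfl⟩ := Finset.mem_image.1 hyc
          exact ⟨i, hyk⟩
        · simp only [Finset.mem_biUnion, Finset.mem_univ, true_and, List.mem_toFinset,
            List.mem_map, List.mem_tails] at hyc
          obtain ⟨i, l, s, hs, rfl⟩ := hyc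
          exact ⟨i, (hqs i l s hs).symm.trans hyk⟩)
      have hzero : (Finset.univ.filter fun i => q (c i) = k) = ∅ :=
        Finset.filter_eq_empty_iff.2 fun i _ h' => hi ⟨i, h'⟩
      rw [hzero, Finset.card_empty]
      push_cast
      omega
  have hsum := Finset.sum_le_sum hmain
  rw [← Finset.sum_mul, Finset.sum_sub_distrib, Finset.sum_add_distrib, Finset.sum_sub_distrib,
    ← Finset.mul_sum, ← Finset.mul_sum] at hsum
  have e₁ := Finset.card_eq_sum_card_fiberwise (s := (Finset.univ : Finset ι)) (t := Q)
    (f := fun i => q (c i)) (fun i _ => Finset.mem_image_of_mem _ (hWV (hcW i)))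
  have e₂ := Finset.card_eq_sum_card_fiberwise (s := E) (t := Q)
    (f := fun e => q e.2) (fun e he => Finset.mem_image_of_mem _ ((hE e).1 he).1)
  have e₃ := Finset.card_eq_sum_card_fiberwise (s := V) (t := Q)
    (f := q) (fun y hy => Finset.mem_image_of_mem _ hy)
  have e₄ := Finset.card_eq_sum_card_fiberwise (s := dirs h V) (t := Q)
    (f := fun d => q d.base) (fun d hd => Finset.mem_image_of_mem _ (base_mem_of_mem_dirs hd))
  have e₅ := Finset.card_eq_sum_card_fiberwise (s := DE) (t := Q)
    (f := fun p => q p.2.base) (fun p hp => Finset.mem_image_of_mem _ (base_mem_of_mem_dirs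
      (Finset.mem_product.1 (Finset.mem_filter.1 hp).1).2))
  have cE : E.card = ∑ j : α, (domain V j).card := by
    rw [Finset.card_eq_sum_card_fiberwise (s := E) (t := Finset.univ) (f := Prod.fst)
      (fun e _ => Finset.mem_coe.2 (Finset.mem_univ _))]
    refine Finset.sum_congr rfl fun j _ => ?_
    refine (Finset.card_bij (fun y _ => (j, y)) ?_ ?_ ?_).symm
    · intro y hy
      exact Finset.mem_filter.2 ⟨(hE _).2 (mem_domain.1 hy), rfl⟩
    · intro y _ y' _ hyy
      exact (Prod.ext_iff.1 hyy).2
    · rintro ⟨j', y⟩ hy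
      obtain ⟨k₁, rfl⟩ := Finset.mem_filter.1 hy
      exact ⟨y, mem_domain.2 ((hE _).1 k₁), rfl⟩
  have cDE : DE.card = ∑ j : α, (dirs h (domain V j)).card := by
    rw [Finset.card_eq_sum_card_fiberwise (s := DE) (t := Finset.univ) (f := Prod.fst)
      (fun e _ => Finset.mem_coe.2 (Finset.mem_univ _))]
    refine Finset.sum_congr rfl fun j _ => ?_
    refine (Finset.card_bij (fun y _ => (j, y)) ?_ ?_ ?_).symm
    · intro y hy
      simp only [DE, Finset.mem_filter, Finset.mem_product, Finset.mem_univ, true_and, and_true]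
      exact ⟨dirs_mono (Finset.filter_subset _ _) hy, hy⟩
    · intro y _ y' _ hyy
      exact (Prod.ext_iff.1 hyy).2
    · rintro ⟨j', y⟩ hy
      obtain ⟨k₁, rfl⟩ := Finset.mem_filter.1 hy
      exact ⟨y, (Finset.mem_filter.1 k₁).2, rfl⟩
  have hdom : 2 * ∑ j : α, (domain V j).card ≤
      ∑ j : α, (dirs h (domain V j)).card + 2 * Fintype.card α := by
    have : ∑ _j : α, 2 = 2 * Fintype.card α := by simp [mul_comm]
    rw [Finset.mul_sum, ← this, ← Finset.sum_add_distrib]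
    refine Finset.sum_le_sum fun j _ => ?_
    rcases (domain V j).eq_empty_or_nonempty with h₀ | h₀
    · rw [h₀]; simp
    · exact (card_dirs h (medianClosed_domain h hVm j) h₀).ge
  have hV := card_dirs h hVm hVne
  rw [Finset.card_univ] at e₁
  have e₃' : V.card = ∑ k ∈ Q, (C k).card := e₃
  zify at e₁ e₂ e₃' e₄ e₅ cE cDE hdom hV
  rw [← e₁, ← e₂, ← e₃', ← e₄, ← e₅] at hsum
  linarith

end Index

end GrowthRate

namespace GrowthRate

open FreeGroup Filter

section LimitTree

variable {α : Type*} [DecidableEq α] {S : Scale} {Φ : FreeGroup α ≃* FreeGroup α}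

lemma ex_le_ex_add_wd (a x b a' x' b' : FreeGroup α) :
    ex a x b ≤ ex a' x' b' + 2 * (wd a a' + wd x x' + wd b b') := by
  have h₁ := wd_triangle a a' x
  have h₂ := wd_triangle a' x' x
  have h₃ := wd_triangle x x' b
  have h₄ := wd_triangle x' b' b
  have h₅ := wd_triangle a' a b'
  have h₆ := wd_triangle a b b'
  rw [wd_comm x' x] at h₂
  rw [wd_comm b' b] at h₄
  rw [wd_comm a' a] at h₅
  unfold ex
  omega

variable (S Φ) in
/-- Sequences of points staying close, at the scale `S`, to the segments `[1, Φ^k p]`. -/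
def PtSeq : Type _ :=
  {y : ℕ → FreeGroup α // ∃ p, S.Negl fun k => ex 1 (y k) ((Φ ^ k) p)}

variable (S Φ) in
/-- Two sequences are equivalent if their distance is negligible. -/
def ptSetoid : Setoid (PtSeq S Φ) where
  r y z := S.Negl fun k => wd (y.1 k) (z.1 k)
  iseqv :=
    { refl := fun _ => (S.negl_const 0).mono fun _ => (wd_self _).le
      symm := fun h => h.mono fun _ => (wd_comm _ _).le
      trans := fun h₁ h₂ => (h₁.add h₂).mono fun _ => wd_triangle _ _ _ }

variable (S Φ) in
/-- The limiting tree of an automorphism at the scale `S`. -/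
def LimitTree : Type _ := Quotient (ptSetoid S Φ)

/-- The point of the limiting tree given by a sequence. -/
def LimitTree.mk (y : PtSeq S Φ) : LimitTree S Φ := Quotient.mk _ y

lemma LimitTree.mk_eq {y z : PtSeq S Φ} :
    LimitTree.mk y = LimitTree.mk z ↔ S.Negl fun k => wd (y.1 k) (z.1 k) :=
  Quotient.eq (r := ptSetoid S Φ)

lemma LimitTree.exists_mk (a : LimitTree S Φ) : ∃ y, LimitTree.mk y = a := Quotient.exists_rep a

lemma ex_trans_le (a x y b : FreeGroup α) : ex a y b ≤ ex a x b + ex a y x := by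
  have := wd_triangle y x b
  unfold ex
  omega

/-- The action on sequences. -/
def PtSeq.smul (g : FreeGroup α) (y : PtSeq S Φ) : PtSeq S Φ :=
  ⟨fun k => (Φ ^ k) g * y.1 k, by
    obtain ⟨p, hp⟩ := y.2
    have h : S.Negl fun k => min (ex 1 ((Φ ^ k) g * y.1 k) ((Φ ^ k) g))
        (ex 1 ((Φ ^ k) g * y.1 k) ((Φ ^ k) (g * p))) := by
      refine hp.mono fun k => ?_
      have := ex_min ((Φ ^ k) g) ((Φ ^ k) g * y.1 k) ((Φ ^ k) (g * p)) 1
      rw [ex_comm ((Φ ^ k) g) _ 1] at this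
      refine this.trans (le_of_eq ?_)
      rw [← ex_mul_left ((Φ ^ k) g) 1, mul_one, _root_.map_mul]
    rcases h.of_min with h | h
    exacts [⟨_, h⟩, ⟨_, h⟩]⟩

instance : MulAction (FreeGroup α) (LimitTree S Φ) where
  smul g := Quotient.map (PtSeq.smul g) fun y z h =>
    Scale.Negl.mono h fun k => (wd_mul_left _ _ _).le
  one_smul a := by
    obtain ⟨y, rfl⟩ := a.exists_mk
    exact LimitTree.mk_eq.2 ((S.negl_const 0).mono fun k => by simp [PtSeq.smul, wd_self])
  mul_smul g h a := by
    obtain ⟨y, rfl⟩ := a.exists_mk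
    exact LimitTree.mk_eq.2 ((S.negl_const 0).mono fun k => by
      simp [PtSeq.smul, wd_self, mul_assoc])

lemma LimitTree.smul_mk (g : FreeGroup α) (y : PtSeq S Φ) :
    g • LimitTree.mk y = LimitTree.mk (y.smul g) := rfl

lemma LimitTree.smul_mk_eq {g : FreeGroup α} {y z : PtSeq S Φ} :
    g • LimitTree.mk y = LimitTree.mk z ↔ S.Negl fun k => wd ((Φ ^ k) g * y.1 k) (z.1 k) :=
  LimitTree.mk_eq

/-- Betweenness in the limiting tree. -/
def LimitTree.Btw (a x b : LimitTree S Φ) : Prop :=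
  S.Negl fun k => ex ((Quotient.out a).1 k) ((Quotient.out x).1 k) ((Quotient.out b).1 k)

lemma LimitTree.negl_wd_out (y : PtSeq S Φ) :
    S.Negl fun k => wd ((Quotient.out (LimitTree.mk y)).1 k) (y.1 k) :=
  LimitTree.mk_eq.1 (Quotient.out_eq (LimitTree.mk y))

lemma LimitTree.btw_mk {a x b : PtSeq S Φ} :
    (LimitTree.mk a).Btw (LimitTree.mk x) (LimitTree.mk b) ↔
      S.Negl fun k => ex (a.1 k) (x.1 k) (b.1 k) := by
  have h := (((negl_wd_out a).add (negl_wd_out x)).add (negl_wd_out b)).const_mul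
    (B := 2) (by norm_num)
  constructor
  · refine fun h' => (Scale.Negl.add h' h).mono fun k => ?_
    have := ex_le_ex_add_wd (a.1 k) (x.1 k) (b.1 k) ((Quotient.out (LimitTree.mk a)).1 k)
      ((Quotient.out (LimitTree.mk x)).1 k) ((Quotient.out (LimitTree.mk b)).1 k)
    rwa [wd_comm (a.1 k), wd_comm (x.1 k), wd_comm (b.1 k)] at this
  · exact fun h' => (Scale.Negl.add h' h).mono fun k => ex_le_ex_add_wd _ _ _ _ _ _

variable (S Φ) in
lemma isPretree_btw : IsPretree (LimitTree.Btw (S := S) (Φ := Φ)) where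
  left a b := by
    obtain ⟨a, rfl⟩ := a.exists_mk
    obtain ⟨b, rfl⟩ := b.exists_mk
    exact LimitTree.btw_mk.2 ((S.negl_const 0).mono fun _ => (ex_left _ _).le)
  symm {a x b} h := by
    obtain ⟨a, rfl⟩ := a.exists_mk
    obtain ⟨b, rfl⟩ := b.exists_mk
    obtain ⟨x, rfl⟩ := x.exists_mk
    exact LimitTree.btw_mk.2 ((LimitTree.btw_mk.1 h).mono fun k => (ex_comm _ _ _).le)
  eq_of_self {a x} h := by
    obtain ⟨a, rfl⟩ := a.exists_mk
    obtain ⟨x, rfl⟩ := x.exists_mk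
    refine LimitTree.mk_eq.2 ((LimitTree.btw_mk.1 h).mono fun k => ?_)
    have h₁ := wd_nonneg (a.1 k) (x.1 k)
    have h₂ := wd_comm (a.1 k) (x.1 k)
    have h₃ := wd_self (a.1 k)
    unfold ex
    omega
  split {a x b} h c := by
    obtain ⟨a, rfl⟩ := a.exists_mk
    obtain ⟨b, rfl⟩ := b.exists_mk
    obtain ⟨x, rfl⟩ := x.exists_mk
    obtain ⟨c, rfl⟩ := c.exists_mk
    rw [LimitTree.btw_mk, LimitTree.btw_mk]
    exact ((LimitTree.btw_mk.1 h).mono fun k => ex_min _ _ _ _).of_min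
  antisymm {a x b} h₁ h₂ := by
    obtain ⟨a, rfl⟩ := a.exists_mk
    obtain ⟨b, rfl⟩ := b.exists_mk
    obtain ⟨x, rfl⟩ := x.exists_mk
    refine LimitTree.mk_eq.2
      (((LimitTree.btw_mk.1 h₁).add (LimitTree.btw_mk.1 h₂)).mono fun k => ?_)
    have h₁ := wd_nonneg (b.1 k) (x.1 k)
    have h₂ := wd_comm (b.1 k) (x.1 k)
    unfold ex
    omega
  median a b c := by
    obtain ⟨a, rfl⟩ := a.exists_mk
    obtain ⟨b, rfl⟩ := b.exists_mk
    obtain ⟨c, rfl⟩ := c.exists_mk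
    choose m h₁ h₂ h₃ using fun k => exists_median (a.1 k) (b.1 k) (c.1 k)
    have hm : ∃ p, S.Negl fun k => ex 1 (m k) ((Φ ^ k) p) := by
      have : S.Negl fun k => min (ex 1 (m k) (a.1 k)) (ex 1 (m k) (b.1 k)) := by
        refine (S.negl_const 0).mono fun k => ?_
        have := ex_min (a.1 k) (m k) (b.1 k) 1
        rwa [h₁, ex_comm _ _ 1] at this
      obtain ⟨p, hp⟩ := a.2
      obtain ⟨p', hp'⟩ := b.2
      rcases this.of_min with h | h
      · exact ⟨p, (hp.add h).mono fun k => ex_trans_le _ _ _ _⟩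
      · exact ⟨p', (hp'.add h).mono fun k => ex_trans_le _ _ _ _⟩
    refine ⟨LimitTree.mk ⟨m, hm⟩, LimitTree.btw_mk.2 ?_, LimitTree.btw_mk.2 ?_,
      LimitTree.btw_mk.2 ?_⟩
    · exact (S.negl_const 0).mono fun k => (h₁ k).le
    · exact (S.negl_const 0).mono fun k => (h₂ k).le
    · exact (S.negl_const 0).mono fun k => (h₃ k).le

variable (S Φ) in
/-- The base point. -/
def LimitTree.basePt : LimitTree S Φ :=
  LimitTree.mk ⟨fun _ => 1, 1, (S.negl_const 0).mono fun _ => (ex_left _ _).le⟩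

lemma LimitTree.btw_smul (g : FreeGroup α) {a x b : LimitTree S Φ} (h : a.Btw x b) :
    (g • a).Btw (g • x) (g • b) := by
  obtain ⟨a, rfl⟩ := a.exists_mk
  obtain ⟨b, rfl⟩ := b.exists_mk
  obtain ⟨x, rfl⟩ := x.exists_mk
  exact LimitTree.btw_mk.2 ((LimitTree.btw_mk.1 h).mono fun k => (ex_mul_left _ _ _ _).le)

lemma LimitTree.smul_eq_of_btw (g : FreeGroup α) {y w u : LimitTree S Φ} (hy : g • y = y)
    (h₁ : y.Btw w u) (h₂ : y.Btw (g • w) u) : g • w = w := by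
  have h₃ : y.Btw w (g • w) ∨ y.Btw (g • w) w := (isPretree_btw S Φ).comparable h₁ h₂
  obtain ⟨y, rfl⟩ := y.exists_mk
  obtain ⟨w, rfl⟩ := w.exists_mk
  rw [LimitTree.smul_mk] at h₃
  have hd := LimitTree.smul_mk_eq.1 hy
  have key : S.Negl fun k => wd ((w.smul g).1 k) (w.1 k) := by
    rcases h₃ with h₃ | h₃ <;>
    · refine ((LimitTree.btw_mk.1 h₃).add hd).mono fun k => ?_
      have e₁ : (w.smul g).1 k = (Φ ^ k) g * w.1 k := rfl
      have e₂ := wd_mul_left ((Φ ^ k) g) (y.1 k) (w.1 k)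
      rw [← e₁] at e₂
      have e₃ := wd_triangle (y.1 k) ((Φ ^ k) g * y.1 k) ((w.smul g).1 k)
      have e₄ := wd_triangle ((Φ ^ k) g * y.1 k) (y.1 k) ((w.smul g).1 k)
      have e₅ := wd_comm (y.1 k) ((Φ ^ k) g * y.1 k)
      have e₆ := wd_comm ((w.smul g).1 k) (w.1 k)
      unfold ex
      omega
  exact LimitTree.mk_eq.2 key

lemma LimitTree.eq_of_fixed [Fintype α] {g : FreeGroup α} (hg : g ≠ 1) {a b : LimitTree S Φ}
    (ha : g • a = a) (hb : g • b = b) (hab : (LimitTree.basePt S Φ).Btw a b) : a = b := by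
  obtain ⟨a, rfl⟩ := a.exists_mk
  obtain ⟨b, rfl⟩ := b.exists_mk
  obtain ⟨p, hp⟩ := b.2
  have hab := LimitTree.btw_mk.1 hab
  have ha' : S.Negl fun k => ex 1 (a.1 k) ((Φ ^ k) p) :=
    (hp.add hab).mono fun k => ex_trans_le _ _ _ _
  replace ha := LimitTree.smul_mk_eq.1 ha
  replace hb := LimitTree.smul_mk_eq.1 hb
  obtain ⟨C, hC⟩ := exists_ex_map_le Φ.symm
  set D : ℕ → ℤ := fun k => wd ((Φ ^ k) g * a.1 k) (a.1 k) + ex 1 (a.1 k) ((Φ ^ k) p) +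
    (wd ((Φ ^ k) g * b.1 k) (b.1 k) + ex 1 (b.1 k) ((Φ ^ k) p)) with hD
  have hDn : S.Negl D := (ha.add ha').add (hb.add hp)
  have near : ∀ (k : ℕ) (y : FreeGroup α), ∃ s, ex 1 s ((Φ ^ k) p) = 0 ∧
      2 * wd y s = ex 1 y ((Φ ^ k) p) ∧
      wd s ((Φ ^ k) g * s) ≤ wd ((Φ ^ k) g * y) y + ex 1 y ((Φ ^ k) p) := by
    intro k y
    obtain ⟨s, h₁, h₂, h₃⟩ := exists_median 1 y ((Φ ^ k) p)
    have h₄ : 2 * wd y s = ex 1 y ((Φ ^ k) p) := by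
      have := wd_comm y s
      unfold ex at *
      omega
    refine ⟨s, h₃, h₄, ?_⟩
    have t₁ := wd_triangle s y ((Φ ^ k) g * s)
    have t₂ := wd_triangle y ((Φ ^ k) g * y) ((Φ ^ k) g * s)
    rw [wd_mul_left] at t₂
    rw [wd_comm ((Φ ^ k) g * y) y]
    rw [wd_comm s y] at t₁
    omega
  refine LimitTree.mk_eq.2 ((hDn.linear_mul (A := 4 * C) (B := p.norm + 6) (by positivity)
    (by positivity)).mono fun k => ?_)
  obtain ⟨s, hs₁, hs₂, hs₃⟩ := near k (a.1 k)
  obtain ⟨t, ht₁, ht₂, ht₃⟩ := near k (b.1 k)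
  have w₁ := wd_nonneg ((Φ ^ k) g * a.1 k) (a.1 k)
  have w₂ := wd_nonneg ((Φ ^ k) g * b.1 k) (b.1 k)
  have w₃ := ex_nonneg 1 (a.1 k) ((Φ ^ k) p)
  have w₄ := ex_nonneg 1 (b.1 k) ((Φ ^ k) p)
  have hmain := wd_le_of_displacement_le hC p k ((Φ ^ k) g) s t (D k) (by simpa using hg)
    hs₁ ht₁ (by simp only [hD]; omega) (by simp only [hD]; omega)
  have t₁ := wd_triangle (a.1 k) s (b.1 k)
  have t₂ := wd_triangle s t (b.1 k)
  rw [wd_comm t] at t₂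
  have : wd (a.1 k) s + wd (b.1 k) t ≤ D k := by simp only [hD]; omega
  linarith

variable (S Φ) in
lemma isTreeAction_btw [Fintype α] :
    IsTreeAction (FreeGroup α) (LimitTree.Btw (S := S) (Φ := Φ)) where
  toIsPretree := isPretree_btw S Φ
  smul g {_ _ _} h := LimitTree.btw_smul g h
  nodil g {_ _ _} hy h₁ h₂ := LimitTree.smul_eq_of_btw g hy h₁ h₂
  arc g {a b} ha hb hab := by
    by_contra hg
    obtain ⟨m, h₁, h₂, h₃⟩ := (isPretree_btw S Φ).median a b (LimitTree.basePt S Φ)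
    have hm : g • m = m := by
      have := LimitTree.btw_smul g h₁
      rw [ha, hb] at this
      exact LimitTree.smul_eq_of_btw g ha h₁ this
    have e₁ := LimitTree.eq_of_fixed hg hm ha ((isPretree_btw S Φ).symm h₃)
    have e₂ := LimitTree.eq_of_fixed hg hm hb ((isPretree_btw S Φ).symm h₂)
    exact hab (e₁.symm.trans e₂)

lemma LimitTree.exists_smul_ne [Fintype α]
    (hS : ∀ (k : ℕ) u, ∃ i, Real.exp (S.rate * k) ≤ wd u ((Φ ^ k) (of i) * u))
    (a : LimitTree S Φ) : ∃ i : α, (of i : FreeGroup α) • a ≠ a := by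
  by_contra! hcon
  obtain ⟨y, rfl⟩ := a.exists_mk
  refine Scale.not_negl (fun k => ?_) (Scale.negl_sum Finset.univ
    fun i _ => LimitTree.smul_mk_eq.1 (hcon i))
  obtain ⟨i, hi⟩ := hS k (y.1 k)
  refine hi.trans ?_
  rw [wd_comm]
  exact_mod_cast Finset.single_le_sum (f := fun i => wd ((Φ ^ k) (of i) * y.1 k) (y.1 k))
    (fun _ _ => wd_nonneg _ _) (Finset.mem_univ i)

variable [Fintype α]

/-- The automorphism acts on sequences. -/
def PtSeq.push (y : PtSeq S Φ) : PtSeq S Φ :=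
  ⟨fun k => Φ (y.1 k), by
    obtain ⟨p, hp⟩ := y.2
    obtain ⟨C, hC⟩ := exists_ex_map_le Φ
    obtain ⟨L, hL⟩ := exists_wd_map_le Φ.toMonoidHom
    choose m h₁ h₂ h₃ using fun k => exists_median 1 (y.1 k) ((Φ ^ k) p)
    refine ⟨Φ p, ((S.negl_const (2 * C)).add (hp.const_mul (B := 2 * L) (by positivity))).mono
      fun k => ?_⟩
    have k₁ := hC _ _ _ (h₃ k)
    have k₂ : wd (Φ (m k)) (Φ (y.1 k)) ≤ L * wd (m k) (y.1 k) := hL _ _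
    have k₃ := ex_le_ex_add (Φ 1) (Φ (m k)) (Φ ((Φ ^ k) p)) (Φ (y.1 k))
    have k₄ : 2 * wd (m k) (y.1 k) = ex 1 (y.1 k) ((Φ ^ k) p) := by
      have h₁ := h₁ k
      have h₂ := h₂ k
      have h₃ := h₃ k
      have := wd_comm (y.1 k) (m k)
      unfold ex at *
      omega
    have k₅ := wd_nonneg (m k) (y.1 k)
    have k₆ : (0 : ℤ) ≤ L := by positivity
    have k₇ : Φ ((Φ ^ k) p) = (Φ ^ k) (Φ p) := by
      rw [← MulAut.mul_apply, ← MulAut.mul_apply, ← pow_succ, ← pow_succ']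
    rw [_root_.map_one, k₇] at k₃ k₁
    nlinarith⟩

lemma LimitTree.mk_push_eq {y z : PtSeq S Φ} :
    LimitTree.mk y.push = LimitTree.mk z.push ↔ LimitTree.mk y = LimitTree.mk z := by
  rw [LimitTree.mk_eq, LimitTree.mk_eq]
  constructor
  · intro h
    obtain ⟨L, hL⟩ := exists_wd_map_le Φ.symm.toMonoidHom
    refine (h.const_mul (B := L) (by positivity)).mono fun k => ?_
    simpa [PtSeq.push] using hL (Φ (y.1 k)) (Φ (z.1 k))
  · intro h
    obtain ⟨L, hL⟩ := exists_wd_map_le Φ.toMonoidHom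
    exact (h.const_mul (B := L) (by positivity)).mono fun k => hL _ _

variable (S Φ) in
/-- The action of the automorphism on the limiting tree. -/
def LimitTree.push : LimitTree S Φ → LimitTree S Φ :=
  Quotient.map PtSeq.push fun _ _ h => Quotient.exact (LimitTree.mk_push_eq.2 (Quotient.sound h))

lemma LimitTree.push_injective : Function.Injective (LimitTree.push S Φ) := by
  intro a b h
  obtain ⟨a, rfl⟩ := a.exists_mk
  obtain ⟨b, rfl⟩ := b.exists_mk
  exact LimitTree.mk_push_eq.1 h

lemma LimitTree.push_smul (g : FreeGroup α) (a : LimitTree S Φ) :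
    LimitTree.push S Φ (g • a) = Φ g • LimitTree.push S Φ a := by
  obtain ⟨a, rfl⟩ := a.exists_mk
  refine LimitTree.mk_eq.2 ((S.negl_const 0).mono fun k => ?_)
  have : Φ ((Φ ^ k) g) = (Φ ^ k) (Φ g) := by
    rw [← MulAut.mul_apply, ← MulAut.mul_apply, ← pow_succ, ← pow_succ']
  simp [PtSeq.smul, PtSeq.push, this, wd_self]

lemma LimitTree.push_iterate_smul (j : ℕ) (g : FreeGroup α) (a : LimitTree S Φ) :
    (LimitTree.push S Φ)^[j] (g • a) = (Φ ^ j) g • (LimitTree.push S Φ)^[j] a := by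
  induction j generalizing a g with
  | zero => simp
  | succ j ih =>
    rw [Function.iterate_succ_apply, Function.iterate_succ_apply, LimitTree.push_smul, ih,
      pow_succ]
    rfl

end LimitTree

/-- A slowly growing element fixes a point of the limiting tree. -/
lemma LimitTree.exists_smul_eq {n : ℕ} {S : Scale} {Φ : FreeGroup (Fin n) ≃* FreeGroup (Fin n)}
    {x : FreeGroup (Fin n)} (hx : S.Negl fun k => cyclicLength ((Φ ^ k) x)) :
    ∃ t : LimitTree S Φ, x • t = t := by
  choose c hc h₁ h₂ h₃ using fun k => exists_axisPoint ((Φ ^ k) x) 1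
  refine ⟨LimitTree.mk ⟨c, x, (S.negl_const 0).mono fun k => ?_⟩,
    LimitTree.smul_mk_eq.2 (hx.mono fun k => ?_)⟩
  · have := h₂ k
    rw [mul_one] at this
    exact this.le
  · obtain ⟨g, hg⟩ := exists_norm_eq_cyclicLength ((Φ ^ k) x)
    rw [wd_comm, ← hg]
    exact (hc k).wd_le_norm_conj g

end GrowthRate

namespace GrowthRate

open FreeGroup Filter Topology

section Comparison

variable {n r : ℕ}

lemma finite_norm_le (m : ℕ) : {g : FreeGroup (Fin n) | g.norm ≤ m}.Finite := by
  refine ((List.finite_length_le (Fin n × Bool) m).image FreeGroup.mk).subset fun g hg => ?_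
  exact ⟨g.toWord, hg, FreeGroup.mk_toWord⟩

lemma exists_cyclicLength_map_le (f : FreeGroup (Fin r) →* FreeGroup (Fin n)) :
    ∃ K : ℕ, ∀ y, cyclicLength (f y) ≤ K * cyclicLength y := by
  obtain ⟨L, hL⟩ := exists_norm_map_le f
  refine ⟨L, fun y => ?_⟩
  obtain ⟨g, hg⟩ := exists_norm_eq_cyclicLength y
  have h := hL (g * y * g⁻¹)
  rw [hg, _root_.map_mul, _root_.map_mul, _root_.map_inv] at h
  exact le_trans (Nat.sInf_le ⟨f g, rfl⟩) h

lemma wd_le_mul_of_steps {w : ℕ → FreeGroup (Fin r)} {K : ℤ} {N : ℕ}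
    (h : ∀ i < N, wd (w i) (w (i + 1)) ≤ K) : wd (w 0) (w N) ≤ K * N := by
  induction N with
  | zero => simp [wd_self]
  | succ N ih =>
    have h₁ := ih fun i hi => h i (by omega)
    have h₂ := h N (by omega)
    have h₃ := wd_triangle (w 0) (w N) (w (N + 1))
    push_cast
    nlinarith

/-- Injective homomorphisms of free groups of finite rank distort cyclic lengths by at most a
multiplicative constant. -/
lemma exists_cyclicLength_le_map {f : FreeGroup (Fin r) →* FreeGroup (Fin n)}
    (hf : Function.Injective f) :
    ∃ K : ℕ, ∀ y, cyclicLength y ≤ K * cyclicLength (f y) := by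
  obtain ⟨L, hL⟩ := exists_norm_map_le f
  have hfin : {g : FreeGroup (Fin r) | (f g).norm ≤ 2 * L + 1}.Finite :=
    (finite_norm_le (2 * L + 1)).preimage hf.injOn
  obtain ⟨K, hK⟩ := (hfin.image FreeGroup.norm).bddAbove
  refine ⟨K, fun y => ?_⟩
  obtain ⟨c, hc, -, hc₁, hc₂⟩ := exists_axisPoint (f y) 1
  obtain ⟨z, N, hz₀, hzN, hz, hzc, hN⟩ := exists_geodesic c (f y * c)
  obtain ⟨s, M, hs₀, hsM, hs, -, -⟩ := exists_geodesic 1 y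
  have hfwd : ∀ a b, wd (f a) (f b) ≤ L * wd a b := fun a b => by
    have := hL (a⁻¹ * b)
    rw [_root_.map_mul, _root_.map_inv] at this
    unfold wd
    exact_mod_cast this
  have hnear : ∀ i, ∃ w, i ≤ N → wd (f w) (z i) ≤ L := by
    intro i
    by_cases hi : i ≤ N
    swap
    · exact ⟨1, fun h => absurd h hi⟩
    have hz1 : ex 1 (z i) (f y) = 0 := by
      have e₁ := hzc i hi
      have e₂ := wd_triangle 1 c (z i)
      have e₃ := wd_triangle (z i) (f y * c) (f y)
      have e₄ : wd (f y * c) (f y) = wd 1 c := by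
        have := wd_mul_left (f y) c 1
        rw [mul_one] at this
        rw [this, wd_comm]
      have e₅ := ex_nonneg 1 (z i) (f y)
      rw [mul_one] at hc₂
      unfold ex at *
      omega
    obtain ⟨j, -, hj⟩ := exists_wd_le_of_path (s := fun i => f (s i)) (n := M) (L := L)
      (by positivity) (fun j _ => (hfwd _ _).trans (by nlinarith [hs j])) (m := z i)
      (by simpa [hs₀, hsM] using hz1)
    exact ⟨s j, fun _ => hj⟩
  choose w hw using hnear
  have key : wd (w 0) (y * w 0) ≤ K * N := by
    set w' : ℕ → FreeGroup (Fin r) := fun i => if i = N then y * w 0 else w i with hw'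
    have h₀ : wd (f (w 0)) c ≤ L := hz₀ ▸ hw 0 (by omega)
    have hnear' : ∀ i ≤ N, wd (f (w' i)) (z i) ≤ L := by
      intro i hi
      by_cases h : i = N
      · simp only [hw', h, if_true, hzN, _root_.map_mul, wd_mul_left]
        exact h₀
      · simpa only [hw', h, if_false] using hw i hi
    rcases Nat.eq_zero_or_pos N with rfl | hpos
    · have : y = 1 := by
        have h : wd c (f y * c) = 0 := by simpa using hN
        have h := wd_eq_zero.1 h
        have h : f y = 1 := by simpa using h.symm
        exact hf (by simpa using h)
      simp [this, wd_self]
    have := wd_le_mul_of_steps (w := w') (K := K) (N := N) fun i hi => by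
      have e₁ := hnear' i hi.le
      have e₂ := hnear' (i + 1) hi
      have e₃ := hz i
      have e₄ := wd_triangle (f (w' i)) (z i) (f (w' (i + 1)))
      have e₅ := wd_triangle (z i) (z (i + 1)) (f (w' (i + 1)))
      rw [wd_comm (z (i + 1))] at e₅
      have e₆ : wd (f (w' i)) (f (w' (i + 1))) ≤ 2 * L + 1 := by omega
      have : ((w' i)⁻¹ * w' (i + 1)).norm ≤ K := by
        refine hK ⟨_, ?_, rfl⟩
        simp only [Set.mem_ofPred_eq, _root_.map_mul, _root_.map_inv]
        unfold wd at e₆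
        exact_mod_cast e₆
      unfold wd
      exact_mod_cast this
    have h0 : w' 0 = w 0 := by simp [hw', hpos.ne]
    have hNN : w' N = y * w 0 := by simp [hw']
    rwa [h0, hNN] at this
  have h₁ := (cyclicLength_le y (w 0)).trans key
  obtain ⟨g, hg⟩ := exists_norm_eq_cyclicLength (f y)
  have h₂ := hc.wd_le_norm_conj g
  rw [hg, hN] at h₂
  have h₃ : N ≤ cyclicLength (f y) := by exact_mod_cast h₂
  have h₄ : cyclicLength y ≤ K * N := by exact_mod_cast h₁
  exact h₄.trans (by gcongr)

end Comparison

section Real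

lemma tendsto_const_div (C : ℝ) : Tendsto (fun k : ℕ => C / (k : ℝ)) atTop (𝓝 0) :=
  tendsto_const_nhds.div_atTop tendsto_natCast_atTop_atTop

lemma tendsto_of_abs_sub_le {u v : ℕ → ℝ} {C ℓ : ℝ} (h : ∀ k, |u k - v k| ≤ C)
    (hv : Tendsto (fun k : ℕ => (1 / (k : ℝ)) * v k) atTop (𝓝 ℓ)) :
    Tendsto (fun k : ℕ => (1 / (k : ℝ)) * u k) atTop (𝓝 ℓ) := by
  have h₀ : Tendsto (fun k : ℕ => (1 / (k : ℝ)) * (u k - v k)) atTop (𝓝 0) := by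
    refine squeeze_zero_norm (fun k => ?_) (tendsto_const_div C)
    rw [norm_mul, Real.norm_of_nonneg (by positivity), one_div, div_eq_inv_mul, Real.norm_eq_abs]
    exact mul_le_mul_of_nonneg_left (h k) (by positivity)
  simpa [mul_sub] using h₀.add hv

lemma abs_log_sub_log_le {a b K : ℕ} (ha : 1 ≤ a) (hb : 1 ≤ b) (hab : a ≤ K * b)
    (hba : b ≤ K * a) : |Real.log a - Real.log b| ≤ Real.log K := by
  have hK : K ≠ 0 := by rintro rfl; omega
  have ha' : (0 : ℝ) < a := by exact_mod_cast ha
  have hb' : (0 : ℝ) < b := by exact_mod_cast hb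
  have hK' : (0 : ℝ) < K := by positivity
  have h₁ : Real.log a ≤ Real.log (K * b) := Real.log_le_log ha' (by exact_mod_cast hab)
  have h₂ : Real.log b ≤ Real.log (K * a) := Real.log_le_log hb' (by exact_mod_cast hba)
  rw [Real.log_mul (by positivity) (by positivity)] at h₁ h₂
  rw [abs_le]
  constructor <;> linarith

lemma abs_sub_le_mul {b : ℕ → ℝ} {C : ℝ} (hb : ∀ k, |b (k + 1) - b k| ≤ C) (k i : ℕ) :
    |b (k + i) - b k| ≤ i * C := by
  induction i with
  | zero => simp
  | succ i ih =>
    have h := abs_sub_le (b (k + (i + 1))) (b (k + i)) (b k)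
    have h' := hb (k + i)
    rw [← add_assoc] at h ⊢
    push_cast
    linarith

/-- If consecutive terms are at bounded distance, the growth along an arithmetic progression
determines the growth of the sequence. -/
lemma tendsto_of_progression {b : ℕ → ℝ} {C ℓ : ℝ} (hb : ∀ k, |b (k + 1) - b k| ≤ C) {q j : ℕ}
    (hq : 0 < q)
    (h : Tendsto (fun m : ℕ => (1 / (m : ℝ)) * b (j + q * m)) atTop (𝓝 ℓ)) :
    Tendsto (fun k : ℕ => (1 / (k : ℝ)) * b k) atTop (𝓝 (ℓ / q)) := by
  have hC : 0 ≤ C := (abs_nonneg _).trans (hb 0)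
  have hq' : (0 : ℝ) < q := by exact_mod_cast hq
  have hdiv : Tendsto (fun k : ℕ => k / q) atTop atTop := Nat.tendsto_div_const_atTop hq.ne'
  have hratio : Tendsto (fun k : ℕ => ((k / q : ℕ) : ℝ) / k) atTop (𝓝 (1 / q)) := by
    rw [tendsto_iff_norm_sub_tendsto_zero]
    refine squeeze_zero' (Eventually.of_forall fun _ => norm_nonneg _) ?_ (tendsto_const_div 1)
    filter_upwards [eventually_gt_atTop 0] with k hk
    have hk' : (0 : ℝ) < k := by exact_mod_cast hk
    have h₁ : ((k % q : ℕ) : ℝ) + q * (k / q : ℕ) = k := by exact_mod_cast Nat.mod_add_div k q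
    have h₂ : ((k % q : ℕ) : ℝ) ≤ q := by exact_mod_cast (Nat.mod_lt k hq).le
    have h₃ : (0 : ℝ) ≤ ((k % q : ℕ) : ℝ) := by positivity
    have h₄ : ((k / q : ℕ) : ℝ) / k - 1 / q = -(((k % q : ℕ) : ℝ) / (q * k)) := by
      field_simp
      linarith
    rw [h₄, norm_neg, Real.norm_of_nonneg (by positivity), div_le_div_iff₀ (by positivity) hk']
    nlinarith
  have hprod := hratio.mul (h.comp hdiv)
  rw [one_div_mul_eq_div] at hprod
  refine tendsto_of_abs_sub_le (v := fun k => b (j + q * (k / q))) (C := (j + q) * C) (fun k => ?_)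
    (hprod.congr' ?_)
  · have h₁ := abs_sub_le_mul hb (q * (k / q)) j
    have h₂ := abs_sub_le_mul hb (q * (k / q)) (k % q)
    rw [Nat.div_add_mod] at h₂
    rw [add_comm] at h₁
    have h₃ : ((k % q : ℕ) : ℝ) * C ≤ q * C := by
      gcongr
      exact (Nat.mod_lt k hq).le
    have h₄ := abs_sub_le (b k) (b (q * (k / q))) (b (j + q * (k / q)))
    rw [abs_sub_comm (b (q * (k / q))) (b (j + q * (k / q)))] at h₄
    linarith
  · filter_upwards [hdiv.eventually (eventually_gt_atTop 0)] with k hk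
    have hk' : ((k / q : ℕ) : ℝ) ≠ 0 := by exact_mod_cast hk.ne'
    simp only [Function.comp]
    field_simp

end Real

section Restriction

variable {n : ℕ}

/-- The statement that `x` has an exponential growth rate under `Φ`. -/
def HasGrowthRate {n : ℕ} (Φ : FreeGroup (Fin n) ≃* FreeGroup (Fin n)) (x : FreeGroup (Fin n)) :
    Prop :=
  ∃ lam : ℝ, 1 ≤ lam ∧ Tendsto (fun k : ℕ => (1 / (k : ℝ)) *
    Real.log (cyclicLength ((Φ ^ k) x))) atTop (𝓝 (Real.log lam))

lemma exists_conj_pow {F : Type*} [Group F] (Φ A : MulAut F) (h : F)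
    (hA : ∀ g, A g = h * Φ g * h⁻¹) (m : ℕ) :
    ∃ u, ∀ g, (A ^ m) g = u * (Φ ^ m) g * u⁻¹ := by
  induction m with
  | zero => exact ⟨1, fun g => by simp⟩
  | succ m ih =>
    obtain ⟨u, hu⟩ := ih
    refine ⟨h * Φ u, fun g => ?_⟩
    rw [pow_succ', pow_succ', MulAut.mul_apply, MulAut.mul_apply, hu, hA]
    simp only [_root_.map_mul, _root_.map_inv]
    group

/-- If an inner twist of `Φ ^ q` preserves a free subgroup of finite rank, the growth of elements
of this subgroup can be computed there. -/
lemma tendsto_of_invariant_subgroup {r : ℕ} {P : Subgroup (FreeGroup (Fin n))}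
    (θ : FreeGroup (Fin r) ≃* P)
    (ih : ∀ (Ψ : FreeGroup (Fin r) ≃* FreeGroup (Fin r)) w, w ≠ 1 → HasGrowthRate Ψ w)
    {Φ : FreeGroup (Fin n) ≃* FreeGroup (Fin n)} {h : FreeGroup (Fin n)}
    (hP : ∀ g, h * Φ g * h⁻¹ ∈ P ↔ g ∈ P) {y : FreeGroup (Fin n)} (hy : y ∈ P) (hy1 : y ≠ 1) :
    HasGrowthRate Φ y := by
  let A : MulAut (FreeGroup (Fin n)) := MulAut.conj h * Φ
  have hA : ∀ g, A g = h * Φ g * h⁻¹ := fun g => rfl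
  have hmap : P.map A.toMonoidHom = P := by
    ext g
    constructor
    · rintro ⟨g, hg, rfl⟩
      exact (hP g).2 hg
    · intro hg
      refine ⟨A.symm g, (hP _).1 ?_, A.apply_symm_apply g⟩
      rw [← hA, A.apply_symm_apply]
      exact hg
  let ψ : P ≃* P := (A.subgroupMap P).trans (MulEquiv.subgroupCongr hmap)
  let Ψ : FreeGroup (Fin r) ≃* FreeGroup (Fin r) := θ.trans (ψ.trans θ.symm)
  let f : FreeGroup (Fin r) →* FreeGroup (Fin n) := P.subtype.comp θ.toMonoidHom
  have hf : Function.Injective f := Subtype.val_injective.comp θ.injective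
  have hfΨ : ∀ w, f (Ψ w) = A (f w) := by
    intro w
    simp [f, Ψ, ψ]
    rfl
  have hfpow : ∀ (m : ℕ) w, f ((Ψ ^ m) w) = (A ^ m) (f w) := by
    intro m
    induction m with
    | zero => intro w; simp
    | succ m ih => intro w; rw [pow_succ', pow_succ', MulAut.mul_apply, MulAut.mul_apply, hfΨ, ih]
  set w := θ.symm ⟨y, hy⟩ with hw
  have hfw : f w = y := by simp [f, hw]
  have hw1 : w ≠ 1 := by
    intro h1
    rw [h1, _root_.map_one] at hfw
    exact hy1 hfw.symm
  obtain ⟨lam, hlam, hlim⟩ := ih Ψ w hw1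
  obtain ⟨K, hK⟩ := exists_cyclicLength_le_map hf
  obtain ⟨K', hK'⟩ := exists_cyclicLength_map_le f
  refine ⟨lam, hlam, tendsto_of_abs_sub_le (C := Real.log ((K + K' : ℕ) : ℝ)) (fun m => ?_) hlim⟩
  have hcl : cyclicLength (f ((Ψ ^ m) w)) = cyclicLength ((Φ ^ m) y) := by
    obtain ⟨u, hu⟩ := exists_conj_pow Φ A h hA m
    rw [hfpow, hfw, hu, cyclicLength_conj]
  have h₁ := hK ((Ψ ^ m) w)
  have h₂ := hK' ((Ψ ^ m) w)
  rw [hcl] at h₁ h₂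
  exact abs_log_sub_log_le (one_le_cyclicLength (by simpa using hy1))
    (one_le_cyclicLength (by simpa using hw1)) (by nlinarith) (by nlinarith)

/-- The growth rate of `x` under `Φ` is determined by that of an iterate under a power. -/
lemma HasGrowthRate.of_pow {Φ : FreeGroup (Fin n) ≃* FreeGroup (Fin n)} {x : FreeGroup (Fin n)}
    (hx : x ≠ 1) {q j : ℕ} (hq : 0 < q) (h : HasGrowthRate (Φ ^ q) ((Φ ^ j) x)) :
    HasGrowthRate Φ x := by
  obtain ⟨lam, hlam, hlim⟩ := h
  obtain ⟨K, hK⟩ := exists_cyclicLength_map_le Φ.toMonoidHom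
  obtain ⟨K', hK'⟩ := exists_cyclicLength_map_le Φ.symm.toMonoidHom
  have hone : ∀ k, 1 ≤ cyclicLength ((Φ ^ k) x) := fun k =>
    one_le_cyclicLength (by simpa using hx)
  refine ⟨Real.exp (Real.log lam / q), Real.one_le_exp
    (div_nonneg (Real.log_nonneg hlam) (by positivity)), ?_⟩
  rw [Real.log_exp]
  refine tendsto_of_progression (b := fun k => Real.log (cyclicLength ((Φ ^ k) x)))
    (C := Real.log ((K + K' : ℕ) : ℝ)) (j := j) (fun k => ?_) hq (hlim.congr fun m => ?_)
  · have h₁ : cyclicLength ((Φ ^ (k + 1)) x) ≤ K * cyclicLength ((Φ ^ k) x) := by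
      rw [pow_succ', MulAut.mul_apply]
      exact hK _
    have h₂ : cyclicLength ((Φ ^ k) x) ≤ K' * cyclicLength ((Φ ^ (k + 1)) x) := by
      have := hK' ((Φ ^ (k + 1)) x)
      rw [pow_succ', MulAut.mul_apply] at this ⊢
      simpa using this
    exact abs_log_sub_log_le (hone _) (hone _) (by nlinarith) (by nlinarith)
  · rw [← pow_mul, add_comm, pow_add, MulAut.mul_apply]

end Restriction

section Stabilizers

open MulAction

/-- Coordinates dual to a family of distinct basis elements of a free subgroup. -/
lemma exists_dual {F : Type*} [Group F] (P : Subgroup F) [IsFreeGroup P] {r : ℕ}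
    (e : Fin r ↪ IsFreeGroup.Generators P) :
    ∃ (χ : Fin r → F → ℚ) (g : Fin r → F),
      (∀ l a b, a ∈ P → b ∈ P → χ l (a * b) = χ l a + χ l b) ∧ (∀ l, g l ∈ P) ∧
      ∀ l l', χ l (g l') = if l = l' then 1 else 0 := by
  classical
  let φ : Fin r → P →* Multiplicative ℚ := fun l =>
    IsFreeGroup.lift fun a => Multiplicative.ofAdd (if e l = a then (1 : ℚ) else 0)
  refine ⟨fun l a => if ha : a ∈ P then Multiplicative.toAdd (φ l ⟨a, ha⟩) else 0,
    fun l => (IsFreeGroup.of (e l) : P), fun l a b ha hb => ?_, fun l => SetLike.coe_mem _,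
    fun l l' => ?_⟩
  · beta_reduce
    rw [dif_pos ha, dif_pos hb, dif_pos (mul_mem ha hb), ← toAdd_mul, ← _root_.map_mul]
    rfl
  · simp [φ]

variable {n : ℕ} {S : Scale} {Φ : FreeGroup (Fin n) ≃* FreeGroup (Fin n)}

lemma stabilizer_rank_lt
    (hS : ∀ (k : ℕ) u, ∃ i, Real.exp (S.rate * k) ≤ wd u ((Φ ^ k) (of i) * u))
    (t : LimitTree S Φ) :
    ∃ r < n, Nonempty (FreeGroup (Fin r) ≃* stabilizer (FreeGroup (Fin n)) t) := by
  classical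
  have hno : IsEmpty (Fin n ↪ IsFreeGroup.Generators (stabilizer (FreeGroup (Fin n)) t)) := by
    refine ⟨fun e => ?_⟩
    obtain ⟨χ, g, h₁, h₂, h₃⟩ := exists_dual _ e
    have := index_bound (isTreeAction_btw S Φ) (LimitTree.exists_smul_ne hS) (ι := Unit)
      (c := fun _ => t) (fun _ _ _ _ => rfl) (χ := fun _ => χ)
      (fun _ l a b ha hb => h₁ l a b ha hb) (g := fun _ => g) (fun _ => h₂) (fun _ => h₃)
    simp only [Fintype.card_unit, Fintype.card_fin] at this
    omega
  have hfin : Finite (IsFreeGroup.Generators (stabilizer (FreeGroup (Fin n)) t)) := by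
    by_contra hinf
    rw [not_finite_iff_infinite] at hinf
    exact hno.false (Fin.valEmbedding.trans (Infinite.natEmbedding _))
  have := Fintype.ofFinite (IsFreeGroup.Generators (stabilizer (FreeGroup (Fin n)) t))
  refine ⟨Fintype.card (IsFreeGroup.Generators (stabilizer (FreeGroup (Fin n)) t)), ?_, ?_⟩
  · by_contra! hle
    exact (Function.Embedding.nonempty_of_card_le (by simpa using hle)).elim hno.false
  · exact ⟨(FreeGroup.freeGroupCongr (Fintype.equivFin _).symm).trans
      (IsFreeGroup.toFreeGroup _).symm⟩

lemma exists_smul_eq_of_stabilizer_ne_bot [NeZero n]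
    (hS : ∀ (k : ℕ) u, ∃ i, Real.exp (S.rate * k) ≤ wd u ((Φ ^ k) (of i) * u))
    {t : ℕ → LimitTree S Φ} (ht : ∀ j, stabilizer (FreeGroup (Fin n)) (t j) ≠ ⊥) :
    ∃ j j', j < j' ∧ ∃ g : FreeGroup (Fin n), g • t j = t j' := by
  classical
  by_contra! hno
  have hgen : ∀ j, Nonempty (Fin 1 ↪ IsFreeGroup.Generators
      (stabilizer (FreeGroup (Fin n)) (t j))) := by
    intro j
    by_contra hempty
    have : IsEmpty (IsFreeGroup.Generators (stabilizer (FreeGroup (Fin n)) (t j))) :=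
      ⟨fun a => hempty ⟨⟨fun _ => a, fun _ _ _ => Subsingleton.elim _ _⟩⟩⟩
    have hsub : Subsingleton (stabilizer (FreeGroup (Fin n)) (t j)) :=
      (IsFreeGroup.toFreeGroup _).toEquiv.subsingleton
    exact ht j (Subgroup.eq_bot_of_subsingleton _)
  choose χ g h₁ h₂ h₃ using fun j => exists_dual _ (hgen j).some
  have : Nonempty (Fin (2 * n)) := ⟨⟨0, by have := NeZero.pos n; omega⟩⟩
  have := index_bound (isTreeAction_btw S Φ) (LimitTree.exists_smul_ne hS) (ι := Fin (2 * n))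
    (c := fun i => t i) (fun i i' a ha => ?_) (χ := fun i => χ i)
    (fun i l a b ha hb => h₁ i l a b ha hb) (g := fun i => g i) (fun i => h₂ i) (fun i => h₃ i)
  · simp only [Fintype.card_fin] at this
    push_cast at this
    omega
  · rcases lt_trichotomy (i : ℕ) i' with h | h | h
    · exact absurd ha (hno _ _ h a)
    · exact Fin.ext h
    · exact absurd (by rw [← ha, inv_smul_smul]) (hno _ _ h a⁻¹)

end Stabilizers

lemma hasGrowthRate (n : ℕ) (Φ : FreeGroup (Fin n) ≃* FreeGroup (Fin n)) (x : FreeGroup (Fin n))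
    (hx : x ≠ 1) : HasGrowthRate Φ x := by
  induction n using Nat.strong_induction_on with
  | _ n ih =>
    rcases Nat.eq_zero_or_pos n with rfl | hn
    · exact absurd (Subsingleton.elim x 1) hx
    have : NeZero n := ⟨hn.ne'⟩
    rcases growth_or_scale Φ hx with h | ⟨S, hxS, hS⟩
    · exact h
    obtain ⟨t, ht⟩ := LimitTree.exists_smul_eq hxS
    have hfix : ∀ j, (Φ ^ j) x • (LimitTree.push S Φ)^[j] t = (LimitTree.push S Φ)^[j] t :=
      fun j => by rw [← LimitTree.push_iterate_smul, ht]
    have hone : ∀ j, (Φ ^ j) x ≠ 1 := fun j => by simpa using hx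
    obtain ⟨j, j', hjj, g, hg⟩ := exists_smul_eq_of_stabilizer_ne_bot hS
      (t := fun j => (LimitTree.push S Φ)^[j] t) fun j hbot =>
        hone j ((Subgroup.eq_bot_iff_forall _).1 hbot _ (hfix j))
    obtain ⟨q, rfl⟩ := Nat.exists_eq_add_of_lt hjj
    obtain ⟨r, hr, ⟨θ⟩⟩ := stabilizer_rank_lt hS ((LimitTree.push S Φ)^[j] t)
    refine HasGrowthRate.of_pow (q := q + 1) (j := j) hx q.succ_pos
      (tendsto_of_invariant_subgroup θ (ih r hr) (h := g⁻¹) (fun a => ?_)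
        (MulAction.mem_stabilizer_iff.2 (hfix j)) (hone j))
    have hg' : g • (LimitTree.push S Φ)^[j] t =
        (LimitTree.push S Φ)^[q + 1] ((LimitTree.push S Φ)^[j] t) := by
      rw [← Function.iterate_add_apply, hg]
      rw [show j + q + 1 = q + 1 + j by ring]
    rw [MulAction.mem_stabilizer_iff, MulAction.mem_stabilizer_iff, inv_inv, mul_assoc, mul_smul,
      inv_smul_eq_iff, mul_smul, hg', ← LimitTree.push_iterate_smul,
      (LimitTree.push_injective.iterate _).eq_iff]

end GrowthRate

/-- Every nontrivial conjugacy class of a finitely generated free group has a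
well-defined asymptotic exponential growth rate under iteration of an
automorphism `Φ`: there is `λ ≥ 1` with `(1/k)·log ‖Φ^k(x)‖_c → log λ`. -/
theorem growth_rate_exists (n : ℕ) (hn : 1 ≤ n)
    (Φ : FreeGroup (Fin n) ≃* FreeGroup (Fin n))
    (x : FreeGroup (Fin n)) (hx : x ≠ 1) :
    ∃ lam : ℝ, 1 ≤ lam ∧
      Filter.Tendsto
        (fun k : ℕ => (1 / (k : ℝ)) * Real.log (cyclicLength ((Φ ^ k) x)))
        Filter.atTop (nhds (Real.log lam)) :=
  GrowthRate.hasGrowthRate n Φ x hx
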